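/- arXiv:2210.11864 — 4 statements merged into one kernel-verified Lean document; each statement's English description precedes it below -/
import Mathlib

section
/- Let r ≥ 2, n ≥ 2r − 1, and let π, β be permutations of Fin n with |support π| = |support β| = 2r − 1 and support π = support β. Suppose there are pairwise distinct elements y_1, …, y_t of Fin n with t ≥ 4 and an s with 2 ≤ s ≤ t − 2 such that the cycle c = (y_1 y_2 … y_t) belongs to the disjoint-cycle factorization of β, and the disjoint-cycle factorization of π consists of all cycles of β except c, together with the two cycles c_1 = (y_1 … y_s) and c_2 = (y_{s+1} … y_t). Then |N_1(π)| ≥ |N_1(β)| and |N_2(π)| ≥ |N_2(β)|. -/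
/-- `N_1(π)`: permutations `σ` with `|support σ| = r - 1` agreeing with `π` on their
support. -/
def N1 {n : ℕ} (r : ℕ) (π : Equiv.Perm (Fin n)) : Finset (Equiv.Perm (Fin n)) :=
  Finset.univ.filter fun σ => σ.support.card = r - 1 ∧ ∀ i ∈ σ.support, σ i = π i

/-- `N_2(π)`: permutations `σ` with `|support σ| = r` agreeing with `π` on their
support. -/
def N2 {n : ℕ} (r : ℕ) (π : Equiv.Perm (Fin n)) : Finset (Equiv.Perm (Fin n)) :=
  Finset.univ.filter fun σ => σ.support.card = r ∧ ∀ i ∈ σ.support, σ i = π i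

theorem invariant_aux {n : ℕ} (π β : Equiv.Perm (Fin n))
    (hsupp : π.support = β.support)
    (l : List (Fin n)) (hl : l.Nodup) (ht : 4 ≤ l.length)
    (s : ℕ)
    (hc : l.formPerm ∈ β.cycleFactorsFinset)
    (hfac : π.cycleFactorsFinset =
      insert (l.take s).formPerm (insert (l.drop s).formPerm
        (β.cycleFactorsFinset.erase l.formPerm)))
    (S : Finset (Fin n)) (hS : S ⊆ β.support) (hinv : ∀ x ∈ S, β x ∈ S) :
    ∀ x ∈ S, π x ∈ S := by
  intro x hx
  have hcyc := (Equiv.Perm.mem_cycleFactorsFinset_iff.1 hc)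
  have hsl : l.formPerm.support = l.toFinset := by
    apply List.support_formPerm_of_nodup _ hl
    rintro y rfl
    simp at ht
  have key : ∀ y ∈ l, x ∈ l → y ∈ S := by
    intro y hy hxl
    have hx' : l.formPerm x ≠ x := by
      rw [← Equiv.Perm.mem_support, hsl]; simpa using hxl
    have hy' : l.formPerm y ≠ y := by
      rw [← Equiv.Perm.mem_support, hsl]; simpa using hy
    obtain ⟨k, hk⟩ := hcyc.1.exists_pow_eq hx' hy'
    have : ∀ k : ℕ, (l.formPerm ^ k) x ∈ S := by
      intro k
      induction k with
      | zero => simpa using hx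
      | succ k ih =>
        rw [pow_succ', Equiv.Perm.mul_apply, hcyc.2]
        · exact hinv _ ih
        · rw [Equiv.Perm.pow_apply_mem_support]; simpa using hx'
    exact hk ▸ this k
  have hxπ : x ∈ π.support := hsupp ▸ hS hx
  have hm := Equiv.Perm.cycleOf_mem_cycleFactorsFinset_iff.2 hxπ
  have hval : π.cycleOf x x = π x := Equiv.Perm.cycleOf_apply_self π x
  have hne : π x ≠ x := Equiv.Perm.mem_support.1 hxπ
  have sub : ∀ l' : List (Fin n), (∀ z ∈ l', z ∈ l) → π.cycleOf x = l'.formPerm → π x ∈ S := by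
    intro l' hl' h
    rw [h] at hval
    have hxl : x ∈ l' := List.mem_of_formPerm_apply_ne (by rw [hval]; exact hne)
    have : l'.formPerm x ∈ l' := List.formPerm_apply_mem_of_mem hxl
    rw [hval] at this
    exact key _ (hl' _ this) (hl' _ hxl)
  rw [hfac, Finset.mem_insert, Finset.mem_insert, Finset.mem_erase] at hm
  rcases hm with h | h | ⟨-, h⟩
  · exact sub _ (fun z hz => List.mem_of_mem_take hz) h
  · exact sub _ (fun z hz => List.mem_of_mem_drop hz) h
  · have := (Equiv.Perm.mem_cycleFactorsFinset_iff.1 h).2 x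
      (by rw [Equiv.Perm.mem_support, hval]; exact hne)
    rw [← hval, this]
    exact hinv _ hx

theorem exists_restrict {n : ℕ} (π : Equiv.Perm (Fin n)) (S : Finset (Fin n))
    (hS : S ⊆ π.support) (hinv : ∀ x ∈ S, π x ∈ S) :
    ∃ τ : Equiv.Perm (Fin n), τ.support = S ∧ ∀ i ∈ S, τ i = π i := by
  have h1 : ∀ i ∈ S, Equiv.Perm.ofSubtype (π.subtypePermOfFintype (p := (· ∈ S)) hinv) i = π i := by
    intro i hi
    rw [Equiv.Perm.ofSubtype_apply_of_mem _ hi]; rfl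
  refine ⟨Equiv.Perm.ofSubtype (π.subtypePermOfFintype (p := (· ∈ S)) hinv), ?_, h1⟩
  ext i
  rw [Equiv.Perm.mem_support]
  by_cases hi : i ∈ S
  · rw [h1 i hi]; exact iff_of_true (Equiv.Perm.mem_support.1 (hS hi)) hi
  · rw [Equiv.Perm.ofSubtype_apply_of_not_mem _ hi]; simp [hi]

theorem card_aux {n : ℕ} (π β : Equiv.Perm (Fin n)) (hsupp : π.support = β.support)
    (H : ∀ S : Finset (Fin n), S ⊆ β.support → (∀ x ∈ S, β x ∈ S) → ∀ x ∈ S, π x ∈ S) (k : ℕ) :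
    (Finset.univ.filter fun σ : Equiv.Perm (Fin n) =>
      σ.support.card = k ∧ ∀ i ∈ σ.support, σ i = β i).card ≤
    (Finset.univ.filter fun σ : Equiv.Perm (Fin n) =>
      σ.support.card = k ∧ ∀ i ∈ σ.support, σ i = π i).card := by
  have ex : ∀ σ : Equiv.Perm (Fin n), ∃ τ : Equiv.Perm (Fin n),
      (∀ i ∈ σ.support, σ i = β i) → τ.support = σ.support ∧ ∀ i ∈ σ.support, τ i = π i := by
    intro σ
    by_cases h : ∀ i ∈ σ.support, σ i = β i
    · have hs : σ.support ⊆ β.support := by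
        intro i hi
        rw [Equiv.Perm.mem_support, ← h i hi]
        exact Equiv.Perm.mem_support.1 hi
      obtain ⟨τ, h1⟩ := exists_restrict π σ.support (hsupp ▸ hs) (H _ hs (by
        intro x hx
        rw [← h x hx]
        exact Equiv.Perm.apply_mem_support.2 hx))
      exact ⟨τ, fun _ => h1⟩
    · exact ⟨1, fun h' => absurd h' h⟩
  choose f hf using ex
  apply Finset.card_le_card_of_injOn f
  · intro σ hσ
    simp only [Finset.coe_filter, Finset.mem_univ, true_and, Set.mem_ofPred_eq] at hσ ⊢
    obtain ⟨h1, h2⟩ := hf σ hσ.2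
    rw [h1]
    exact ⟨hσ.1, h2⟩
  · intro σ hσ τ hτ he
    simp only [Finset.coe_filter, Finset.mem_univ, true_and, Set.mem_ofPred_eq] at hσ hτ
    have hs : σ.support = τ.support := by
      rw [← (hf σ hσ.2).1, he, (hf τ hτ.2).1]
    ext i
    by_cases hi : i ∈ σ.support
    · rw [hσ.2 i hi, hτ.2 i (hs ▸ hi)]
    · have hi' := hi
      rw [hs] at hi'
      rw [Equiv.Perm.notMem_support.1 hi, Equiv.Perm.notMem_support.1 hi']

/-- Let `r ≥ 2`, `n ≥ 2r - 1`, and `π`, `β` permutations of `Fin n` with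
equal supports of size `2r - 1`. Suppose `l = [y_1, …, y_t]` is a list of pairwise
distinct elements with `t ≥ 4`, `2 ≤ s ≤ t - 2`, the cycle `c = (y_1 … y_t)` (realized
as `l.formPerm`) belongs to the disjoint-cycle factorization of `β`, and the
factorization of `π` consists of all cycles of `β` except `c` together with the cycles
`(y_1 … y_s)` and `(y_{s+1} … y_t)`. Then `|N_1(π)| ≥ |N_1(β)|` and
`|N_2(π)| ≥ |N_2(β)|`. -/
theorem stmt12 (n r : ℕ) (hr : 2 ≤ r) (hn : 2 * r - 1 ≤ n)
    (π β : Equiv.Perm (Fin n))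
    (hπ : π.support.card = 2 * r - 1) (hβ : β.support.card = 2 * r - 1)
    (hsupp : π.support = β.support)
    (l : List (Fin n)) (hl : l.Nodup) (ht : 4 ≤ l.length)
    (s : ℕ) (hs2 : 2 ≤ s) (hst : s ≤ l.length - 2)
    (hc : l.formPerm ∈ β.cycleFactorsFinset)
    (hfac : π.cycleFactorsFinset =
      insert (l.take s).formPerm (insert (l.drop s).formPerm
        (β.cycleFactorsFinset.erase l.formPerm))) :
    (N1 r β).card ≤ (N1 r π).card ∧ (N2 r β).card ≤ (N2 r π).card := by
  have H := invariant_aux π β hsupp l hl ht s hc hfac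
  exact ⟨card_aux π β hsupp H _, card_aux π β hsupp H _⟩
end

section
/- Let t ≥ 2, let r = 2t or r = 2t + 1, let 2 ≤ s ≤ r, set ℓ = 2s − 1, and let n ≥ 2r − 1. Then there exists a permutation π of Fin n whose cycle type consists of r − s parts equal to 2 together with one part equal to ℓ (so |support π| = 2r − 1) such that |B_r(π) ∩ B_r(1)| = 2·C(r−s, t) + ℓ · Σ_{i=1}^{s−1} C(r−s, t−i) if r = 2t, and |B_r(π) ∩ B_r(1)| = 2·C(r−s, t) + ℓ · Σ_{i=1}^{s−2} C(r−s, t−i) if r = 2t + 1. -/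
/-- The Hamming distance between two permutations of `Fin n`. -/
def hdist {n : ℕ} (π τ : Equiv.Perm (Fin n)) : ℕ :=
  (Finset.univ.filter fun i => π i ≠ τ i).card

/-- The metric ball of radius `r` centered at `π` for the Hamming distance. -/
def pball {n : ℕ} (π : Equiv.Perm (Fin n)) (r : ℕ) : Finset (Equiv.Perm (Fin n)) :=
  Finset.univ.filter fun σ => hdist π σ ≤ r

open Equiv Equiv.Perm

/-- conj arc -/
def arcP {m : ℕ} (y d : Fin (m+1)) : Perm (Fin (m+1)) :=
  (Equiv.addRight y).permCongr (Fin.cycleRange d)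

lemma arcP_apply {m : ℕ} (y d x : Fin (m+1)) : arcP y d (x + y) = Fin.cycleRange d x + y := by
  simp [arcP]

lemma cyc_unique {m : ℕ} (c : Perm (Fin (m+1))) (d : Fin (m+1)) (h0 : c d = 0)
    (h : ∀ j, j ≠ d → c j = j ∨ c j = j + 1) : c = Fin.cycleRange d := by
  have hlt : ∀ k : ℕ, ∀ hk : k < m + 1, k < d.val → (c ⟨k, hk⟩).val = k + 1 := by
    intro k
    have val1 : ∀ j : Fin (m+1), j.val < d.val → (j+1).val = j.val + 1 := by
      intro j hj
      exact Fin.val_add_one_of_lt (lt_of_lt_of_le (Fin.lt_def.2 hj) (Fin.le_last d))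
    induction k with
    | zero =>
      intro hk hkd
      have hne : (⟨0, hk⟩ : Fin (m+1)) ≠ d := by
        intro e; rw [← e] at hkd; simp at hkd
      rcases h _ hne with h1 | h1
      · exact absurd (c.injective (h1.trans (by rw [h0]; rfl))) hne
      · rw [h1]; exact val1 _ hkd
    | succ k ih =>
      intro hk hkd
      have hne : (⟨k+1, hk⟩ : Fin (m+1)) ≠ d := by
        intro e; rw [← e] at hkd; simp at hkd
      rcases h _ hne with h1 | h1
      · have h2 := ih (by omega) (by omega)
        have h3 : c ⟨k, by omega⟩ = c ⟨k+1, hk⟩ := by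
          rw [h1]; ext; exact h2
        have := c.injective h3
        simp at this
      · rw [h1]; exact val1 _ hkd
  have hgt : ∀ k : ℕ, ∀ hk : k < m + 1, d.val < k → c ⟨k, hk⟩ = ⟨k, hk⟩ := by
    intro k
    induction k with
    | zero => intro _ h; omega
    | succ k ih =>
      intro hk hkd
      obtain ⟨z, hz⟩ := c.surjective ⟨k+1, hk⟩
      have hzd : z ≠ d := by
        rintro rfl; rw [h0] at hz; simp [Fin.ext_iff] at hz
      rcases h z hzd with h1 | h1
      · rw [h1] at hz; rw [hz] at h1; exact h1
      · rw [hz] at h1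
        have hzl : z ≠ Fin.last m := by
          rintro rfl; simp [Fin.ext_iff] at h1
        have hz1 : z.val = k := by
          have := Fin.val_add_one_of_lt (Fin.lt_last_iff_ne_last.2 hzl)
          rw [← h1] at this; simp at this; omega
        have hze : z = ⟨k, by omega⟩ := Fin.ext hz1
        have : d.val ≠ k := fun e => hzd (Fin.ext (by omega))
        have h2 := ih (by omega) (by omega)
        rw [← hze, hz] at h2
        have := congrArg Fin.val h2
        simp at this; omega
  ext j
  rcases lt_trichotomy j d with hj | hj | hj
  · rw [Fin.coe_cycleRange_of_lt hj]; exact hlt j.val j.2 hj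
  · subst hj; rw [h0, Fin.cycleRange_self]
  · rw [Fin.cycleRange_of_gt hj]; exact congrArg Fin.val (hgt j.val j.2 hj)

lemma arc_unique {m : ℕ} (c : Perm (Fin (m+1))) (x0 : Fin (m+1))
    (h : ∀ j, j ≠ x0 → c j = j ∨ c j = j + 1) : c = arcP (c x0) (x0 - c x0) := by
  have key : (Equiv.subRight (c x0)).permCongr c = Fin.cycleRange (x0 - c x0) := by
    apply cyc_unique
    · simp
    · intro j hj
      have : j + c x0 ≠ x0 := fun e => hj (eq_sub_of_add_eq e)
      rcases h _ this with h1 | h1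
      · left; simp [h1]
      · right; simp [h1]; abel
  ext x
  rw [arcP, ← key]
  simp

lemma arcP_zero {m : ℕ} (y : Fin (m+1)) : arcP y 0 = 1 := by
  ext x; simp [arcP]

lemma arcP_last {m : ℕ} (y : Fin (m+1)) : arcP y (Fin.last m) = finRotate (m+1) := by
  ext x; simp [arcP, Fin.cycleRange_last]; congr 1; abel

lemma add_one_ne {m : ℕ} (hm : 0 < m) (x : Fin (m+1)) : x + 1 ≠ x := by
  intro h
  have : (1 : Fin (m+1)) = 0 := by simpa using h
  have := congrArg Fin.val this
  rw [Fin.val_one'] at this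
  rw [Nat.mod_eq_of_lt (by omega)] at this
  simp at this

lemma cyc_ne_self {m : ℕ} (d j : Fin (m+1)) :
    Fin.cycleRange d j ≠ j ↔ d ≠ 0 ∧ j ≤ d := by
  rcases lt_trichotomy j d with hj | hj | hj
  · have h := Fin.coe_cycleRange_of_lt hj
    have : d ≠ 0 := by rintro rfl; simp at hj
    simp only [this, hj.le, ne_eq, not_false_eq_true, and_self, iff_true]
    intro e; rw [e] at h; omega
  · subst hj; rw [Fin.cycleRange_self]; simp [eq_comm]
  · rw [Fin.cycleRange_of_gt hj]; simp [hj]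

lemma cyc_ne_succ {m : ℕ} (hm : 0 < m) (d j : Fin (m+1)) :
    Fin.cycleRange d j ≠ j + 1 ↔ d ≠ Fin.last m ∧ d ≤ j := by
  rcases lt_trichotomy j d with hj | hj | hj
  · rw [Fin.cycleRange_of_lt hj]; simp [hj]
  · subst hj; rw [Fin.cycleRange_self]
    simp only [ne_eq, le_refl, and_true]
    rw [not_iff_not]
    constructor
    · intro h
      by_contra h1
      have := Fin.val_add_one_of_lt (Fin.lt_last_iff_ne_last.2 h1)
      rw [← h] at this; simp at this
    · rintro rfl; simp
  · rw [Fin.cycleRange_of_gt hj]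
    have : d ≠ Fin.last m := (lt_of_lt_of_le hj (Fin.le_last j)).ne
    simp [this, hj.le]
    have := add_one_ne hm j
    intro h; exact absurd h (by omega)

lemma arc_supp {m : ℕ} (y d : Fin (m+1)) :
    (Finset.univ.filter fun x => arcP y d x ≠ x).card = if d = 0 then 0 else d.val + 1 := by
  have : (Finset.univ.filter fun x => arcP y d x ≠ x).card
      = (Finset.univ.filter fun x => Fin.cycleRange d x ≠ x).card := by
    symm
    apply Finset.card_bij (fun x _ => x + y)
    · intro x; simp [arcP_apply]
    · intro a _ b _ h; simpa using h
    · intro b hb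
      refine ⟨b - y, ?_, by simp⟩
      simp only [Finset.mem_filter, Finset.mem_univ, true_and] at hb ⊢
      intro e; apply hb
      have := arcP_apply y d (b - y)
      rw [e] at this; simpa using this
  rw [this]
  simp only [cyc_ne_self]
  split_ifs with h
  · simp [h]
  · simp only [h, ne_eq, not_false_eq_true, true_and]
    have : (Finset.univ.filter fun x => x ≤ d) = Finset.Iic d := by ext; simp
    rw [this, Fin.card_Iic]

lemma arc_diff {m : ℕ} (hm : 0 < m) (y d : Fin (m+1)) :
    (Finset.univ.filter fun x => arcP y d x ≠ x + 1).card
      = if d = Fin.last m then 0 else m + 1 - d.val := by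
  have : (Finset.univ.filter fun x => arcP y d x ≠ x + 1).card
      = (Finset.univ.filter fun x => Fin.cycleRange d x ≠ x + 1).card := by
    symm
    apply Finset.card_bij (fun x _ => x + y)
    · intro x
      have : x + y + 1 = (x + 1) + y := by abel
      simp [arcP_apply, this]
    · intro a _ b _ h; simpa using h
    · intro b hb
      refine ⟨b - y, ?_, by simp⟩
      simp only [Finset.mem_filter, Finset.mem_univ, true_and] at hb ⊢
      intro e; apply hb
      have := arcP_apply y d (b - y)
      have h2 : b - y + 1 + y = b + 1 := by abel
      rw [e, h2] at this; simpa using this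
  rw [this]
  simp only [cyc_ne_succ hm]
  split_ifs with h
  · simp [h]
  · simp only [h, ne_eq, not_false_eq_true, true_and]
    have : (Finset.univ.filter fun x => d ≤ x) = Finset.Ici d := by ext; simp
    rw [this, Fin.card_Ici]

/-- normalized parameters -/
def good {m : ℕ} (y d : Fin (m+1)) : Prop := (d = 0 ∨ d = Fin.last m) → y = 0

lemma arc_inj {m : ℕ} (hm : 0 < m) (y d y' d' : Fin (m+1)) (h : good y d) (h' : good y' d')
    (e : arcP y d = arcP y' d') : y = y' ∧ d = d' := by
  have hd : d = d' := by
    have h1 := arc_supp y d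
    rw [e, arc_supp] at h1
    split_ifs at h1 with h2 h3 h3
    · rw [h2, h3]
    · omega
  subst hd
  refine ⟨?_, rfl⟩
  by_cases hc : d = 0 ∨ d = Fin.last m
  · rw [h hc, h' hc]
  · push Not at hc
    obtain ⟨h0, h1⟩ := hc
    -- the bad point
    have bad : ∀ j, (Fin.cycleRange d j ≠ j ∧ Fin.cycleRange d j ≠ j + 1) → j = d := by
      intro j ⟨ha, hb⟩
      exact le_antisymm ((cyc_ne_self d j).1 ha).2 ((cyc_ne_succ hm d j).1 hb).2
    have e1 : arcP y' d (d + y) = y := by rw [← e, arcP_apply, Fin.cycleRange_self, zero_add]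
    have e2 := arcP_apply y' d (d + y - y')
    rw [sub_add_cancel, e1] at e2
    have e3 : Fin.cycleRange d (d + y - y') = y - y' := eq_sub_of_add_eq e2.symm
    have := bad (d + y - y') (by
      rw [e3]
      constructor
      · intro e; apply h0
        have : d = (d + y - y') - (y - y') := by abel
        rw [← e, sub_self] at this; exact this
      · intro e; apply h1
        have h3 : d + 1 = 0 := by
          have : d + 1 = (d + y - y' + 1) - (y - y') := by abel
          rw [← e, sub_self] at this; exact this
        have h4 := Fin.last_add_one m
        exact add_right_cancel (h3.trans h4.symm))
    rw [this, Fin.cycleRange_self] at e3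
    exact (sub_eq_zero.1 e3.symm)

/-- flip the pairs indexed by J -/
def flipP {q : ℕ} (J : Finset (Fin q)) : Perm (Fin q × Bool) where
  toFun x := (x.1, xor x.2 (decide (x.1 ∈ J)))
  invFun x := (x.1, xor x.2 (decide (x.1 ∈ J)))
  left_inv x := by simp
  right_inv x := by simp

/-- the underlying type -/
abbrev XX (q m e : ℕ) := (Fin q × Bool) ⊕ (Fin (m+1) ⊕ Fin e)

/-- block permutation -/
def Phi {q m : ℕ} (e : ℕ) (J : Finset (Fin q)) (c : Perm (Fin (m+1))) : Perm (XX q m e) :=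
  Equiv.sumCongr (flipP J) (Equiv.sumCongr c 1)

/-- general Hamming distance -/
def hd {X : Type*} [Fintype X] [DecidableEq X] (π τ : Perm X) : ℕ :=
  (Finset.univ.filter fun i => π i ≠ τ i).card

lemma hd_Phi {q m : ℕ} (e : ℕ) (J K : Finset (Fin q)) (c b : Perm (Fin (m+1))) :
    hd (Phi e J c) (Phi e K b) = 2 * (Finset.univ.filter fun i => ¬ (i ∈ J ↔ i ∈ K)).card
      + (Finset.univ.filter fun x => c x ≠ b x).card := by
  unfold hd
  rw [Finset.card_filter, Fintype.sum_sum_type, Fintype.sum_sum_type, Fintype.sum_prod_type]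
  rw [Finset.card_filter, Finset.card_filter, Finset.mul_sum]
  have h3 : ∑ x : Fin e, (if (Phi e J c) (Sum.inr (Sum.inr x)) ≠
      (Phi e K b) (Sum.inr (Sum.inr x)) then 1 else 0) = 0 := by
    simp [Phi]
  rw [h3, add_zero]
  congr 1
  · apply Finset.sum_congr rfl
    intro i _
    rw [Fintype.sum_bool]
    by_cases h1 : i ∈ J <;> by_cases h2 : i ∈ K <;> simp [Phi, flipP, h1, h2]
  · apply Finset.sum_congr rfl
    intro i _
    simp [Phi]

lemma flipP_empty {q : ℕ} : flipP (∅ : Finset (Fin q)) = 1 := by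
  ext x <;> simp [flipP]

lemma Phi_one {q m e : ℕ} : Phi e (∅ : Finset (Fin q)) (1 : Perm (Fin (m+1))) = 1 := by
  rw [Phi, flipP_empty]; ext x; simp

lemma Phi_inj {q m : ℕ} (e : ℕ) (J K : Finset (Fin q)) (c b : Perm (Fin (m+1)))
    (h : Phi e J c = Phi e K b) : J = K ∧ c = b := by
  constructor
  · ext i
    have := congrArg (fun f => f (Sum.inl (i, false))) h
    simpa [Phi, flipP] using this
  · ext x
    have := congrArg (fun f => f (Sum.inr (Sum.inl x))) h
    simp [Phi] at this
    rw [this]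

lemma fiber_inv {X B : Type*} [Finite X] (σ π : Perm X) (β : X → B) (hβ : ∀ x, β (π x) = β x)
    (x0 : X) (h : ∀ x, x ≠ x0 → σ x = x ∨ σ x = π x) (x : X) : β (σ x) = β x := by
  have h1 : ∀ x, x ≠ x0 → β (σ x) = β x := by
    intro x hx
    rcases h x hx with e | e <;> rw [e]
    exact hβ x
  by_cases hx : x = x0
  · subst hx
    by_contra hne
    have hmaps : ∀ z : {z // β z = β (σ x)}, β (σ z.1) = β (σ x) := by
      rintro ⟨z, hz⟩
      have : z ≠ x := by rintro rfl; exact hne hz.symm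
      exact (h1 z this).trans hz
    let f : {z // β z = β (σ x)} → {z // β z = β (σ x)} := fun z => ⟨σ z.1, hmaps z⟩
    have hf : Function.Injective f := by
      intro a b hab
      have := congrArg Subtype.val hab
      exact Subtype.ext (σ.injective this)
    obtain ⟨z, hz⟩ := Finite.surjective_of_injective hf ⟨σ x, rfl⟩
    have := σ.injective (congrArg Subtype.val hz)
    exact hne (by rw [← z.2, this])
  · exact h1 x hx

/-- block index -/
def blk {q m e : ℕ} : XX q m e → Fin q ⊕ (Unit ⊕ Fin e) :=
  Sum.map Prod.fst (Sum.map (fun _ => ()) id)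

lemma decomp {q m e : ℕ} (σ : Perm (XX q m e)) (x0 : XX q m e)
    (h : ∀ x, x ≠ x0 → σ x = x ∨ σ x = Phi e Finset.univ (finRotate (m+1)) x) :
    ∃ (J : Finset (Fin q)) (y d : Fin (m+1)), good y d ∧ σ = Phi e J (arcP y d) := by
  have hb := fiber_inv σ _ blk (by
    rintro (⟨i, b⟩ | x | z) <;> simp [blk, Phi, flipP]) x0 h
  have hpair : ∀ i b, ∃ b', σ (Sum.inl (i, b)) = Sum.inl (i, b') := by
    intro i b
    have := hb (Sum.inl (i, b))
    rcases hs : σ (Sum.inl (i, b)) with ⟨i', b'⟩ | x | z <;> rw [hs] at this <;> simp [blk] at this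
    subst this; exact ⟨b', rfl⟩
  have hcyc : ∀ x, ∃ x', σ (Sum.inr (Sum.inl x)) = Sum.inr (Sum.inl x') := by
    intro x
    have := hb (Sum.inr (Sum.inl x))
    rcases hs : σ (Sum.inr (Sum.inl x)) with ⟨i', b'⟩ | x | z <;> rw [hs] at this <;>
      simp [blk] at this
    exact ⟨x, rfl⟩
  have hfix : ∀ z, σ (Sum.inr (Sum.inr z)) = Sum.inr (Sum.inr z) := by
    intro x
    have := hb (Sum.inr (Sum.inr x))
    rcases hs : σ (Sum.inr (Sum.inr x)) with ⟨i', b'⟩ | x | z <;> rw [hs] at this <;>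
      simp [blk] at this
    rw [this]
  choose g hg using hpair
  choose f hf using hcyc
  have finj : Function.Injective f := by
    intro a b hab
    have : σ (Sum.inr (Sum.inl a)) = σ (Sum.inr (Sum.inl b)) := by rw [hf, hf, hab]
    simpa using σ.injective this
  let c : Perm (Fin (m+1)) := Equiv.ofBijective f (Finite.injective_iff_bijective.1 finj)
  have hc : ∀ x, c x = f x := fun _ => rfl
  have hgood : ∃ w, ∀ j, j ≠ w → c j = j ∨ c j = j + 1 := by
    have key : ∀ j, Sum.inr (Sum.inl j) ≠ x0 → c j = j ∨ c j = j + 1 := by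
      intro j hj
      have := h _ hj
      rw [hf] at this
      simpa [Phi, hc] using this
    rcases x0 with p | w | z
    · exact ⟨0, fun j _ => key j (by simp)⟩
    · exact ⟨w, fun j hj => key j (by simpa using hj)⟩
    · exact ⟨0, fun j _ => key j (by simp)⟩
  obtain ⟨w, hw⟩ := hgood
  have hcarc := arc_unique c w hw
  have hnorm : ∃ y d, good y d ∧ c = arcP y d := by
    by_cases h0 : w - c w = 0
    · refine ⟨0, 0, fun _ => rfl, ?_⟩
      rw [hcarc, h0, arcP_zero, arcP_zero]
    by_cases h1 : w - c w = Fin.last m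
    · refine ⟨0, Fin.last m, fun _ => rfl, ?_⟩
      rw [hcarc, h1, arcP_last, arcP_last]
    · refine ⟨_, _, ?_, hcarc⟩
      rintro (h | h)
      · exact absurd h h0
      · exact absurd h h1
  obtain ⟨y, d, hyd, hcyd⟩ := hnorm
  refine ⟨Finset.univ.filter fun i => g i false = true, y, d, hyd, ?_⟩
  rw [← hcyd]
  ext1 x
  rcases x with ⟨i, b⟩ | x | z
  · rw [hg]
    have hne : g i true ≠ g i false := by
      intro h
      have : σ (Sum.inl (i, true)) = σ (Sum.inl (i, false)) := by rw [hg, hg, h]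
      simpa using σ.injective this
    cases h1 : g i false <;> cases h2 : g i true <;> rw [h1, h2] at hne
    · exact absurd rfl hne
    · cases b <;> simp [Phi, flipP, h1, h2]
    · cases b <;> simp [Phi, flipP, h1, h2]
    · exact absurd rfl hne
  · rw [hf]; simp [Phi, hc]
  · rw [hfix]; simp [Phi]

lemma card_supp {q m e : ℕ} (hm : 0 < m) :
    (Finset.univ.filter fun x : XX q m e => Phi e Finset.univ (finRotate (m+1)) x ≠ x).card
      = 2 * q + (m + 1) := by
  have := hd_Phi e Finset.univ (∅ : Finset (Fin q)) (finRotate (m+1)) 1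
  rw [Phi_one] at this
  unfold hd at this
  have h2 : ∀ x : Fin (m+1), finRotate (m+1) x ≠ x := by
    intro x; rw [finRotate_apply]; exact add_one_ne hm x
  simp [add_one_ne hm] at this
  simp only [ne_eq]
  convert this using 2
  ext x
  constructor <;> intro h <;>
    exact Finset.mem_filter.2 ⟨Finset.mem_univ _, (Finset.mem_filter.1 h).2⟩

lemma exists_bad {X : Type*} [Fintype X] [DecidableEq X] [Nonempty X] (σ π : Perm X) (r : ℕ)
    (hπ : 2 * r - 1 ≤ (Finset.univ.filter fun x => π x ≠ x).card)
    (h1 : hd π σ ≤ r) (h2 : hd 1 σ ≤ r) :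
    ∃ x0, ∀ x, x ≠ x0 → σ x = x ∨ σ x = π x := by
  let A := Finset.univ.filter fun x => π x ≠ σ x
  let B := Finset.univ.filter fun x => (1 : Perm X) x ≠ σ x
  have hAB : (A ∩ B).card ≤ 1 := by
    have := Finset.card_union_add_card_inter A B
    have h3 : (Finset.univ.filter fun x => π x ≠ x).card ≤ (A ∪ B).card := by
      apply Finset.card_le_card
      intro x; simp only [A, B, Finset.mem_filter, Finset.mem_union, Finset.mem_univ, true_and]
      intro hx
      by_contra hcon
      push Not at hcon
      exact hx (hcon.1.trans hcon.2.symm)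
    unfold hd at h1 h2
    have h1' : A.card ≤ r := h1
    have h2' : B.card ≤ r := h2
    omega
  rw [Finset.card_le_one_iff_subset_singleton] at hAB
  obtain ⟨x0, hx0⟩ := hAB
  refine ⟨x0, fun x hx => ?_⟩
  by_contra hcon
  push Not at hcon
  apply hx
  have : x ∈ A ∩ B := by
    simp only [A, B, Finset.mem_filter, Finset.mem_inter, Finset.mem_univ, true_and]
    exact ⟨hcon.2.symm, hcon.1.symm⟩
  simpa using hx0 this

instance {m : ℕ} (y d : Fin (m+1)) : Decidable (good y d) := by unfold good; infer_instance

lemma count1 {q m e r : ℕ} (hm : 0 < m) (hr : 2 * q + (m + 1) = 2 * r - 1) :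
    (Finset.univ.filter fun σ : Perm (XX q m e) =>
      hd (Phi e Finset.univ (finRotate (m+1))) σ ≤ r ∧ hd 1 σ ≤ r).card =
    ∑ y : Fin (m+1), ∑ d : Fin (m+1), if good y d then
      (Finset.univ.filter fun J : Finset (Fin q) =>
        2 * (q - J.card) + (if d = Fin.last m then 0 else m + 1 - d.val) ≤ r ∧
        2 * J.card + (if d = 0 then 0 else d.val + 1) ≤ r).card else 0 := by
  have hcond : ∀ (J : Finset (Fin q)) (y d : Fin (m+1)),
      (hd (Phi e Finset.univ (finRotate (m+1))) (Phi e J (arcP y d)) =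
        2 * (q - J.card) + (if d = Fin.last m then 0 else m + 1 - d.val)) ∧
      (hd 1 (Phi e J (arcP y d)) = 2 * J.card + (if d = 0 then 0 else d.val + 1)) := by
    intro J y d
    constructor
    · rw [hd_Phi, ← arc_diff hm y d]
      congr 2
      · have : (Finset.univ.filter fun i => ¬ (i ∈ (Finset.univ : Finset (Fin q)) ↔ i ∈ J)) = Jᶜ := by
          ext; simp
        rw [this, Finset.card_compl, Fintype.card_fin]
      · ext x; simp [eq_comm]
    · rw [← Phi_one, hd_Phi, ← arc_supp y d]
      congr 1
      · congr 2; ext; simp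
      · congr 1; ext x
        constructor <;> intro h <;>
          exact Finset.mem_filter.2 ⟨Finset.mem_univ _, Ne.symm (Finset.mem_filter.1 h).2⟩
  let T : Finset (Fin (m+1) × Fin (m+1) × Finset (Fin q)) := Finset.univ.filter fun p =>
    good p.1 p.2.1 ∧ 
        2 * (q - p.2.2.card) + (if p.2.1 = Fin.last m then 0 else m + 1 - p.2.1.val) ≤ r ∧
        2 * p.2.2.card + (if p.2.1 = 0 then 0 else p.2.1.val + 1) ≤ r
  have hT : T.card = ∑ y : Fin (m+1), ∑ d : Fin (m+1), if good y d then
      (Finset.univ.filter fun J : Finset (Fin q) =>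
        2 * (q - J.card) + (if d = Fin.last m then 0 else m + 1 - d.val) ≤ r ∧
        2 * J.card + (if d = 0 then 0 else d.val + 1) ≤ r).card else 0 := by
    simp only [T]
    rw [Finset.card_filter, Fintype.sum_prod_type]
    refine Finset.sum_congr rfl fun y _ => ?_
    rw [Fintype.sum_prod_type]
    refine Finset.sum_congr rfl fun d _ => ?_
    by_cases hg : good y d
    · simp only [hg, true_and, if_true]; rw [Finset.card_filter]
    · simp [hg]
  rw [← hT]
  symm
  apply Finset.card_bij (fun p _ => Phi e p.2.2 (arcP p.1 p.2.1))
  · rintro ⟨y, d, J⟩ hp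
    simp only [T, Finset.mem_filter, Finset.mem_univ, true_and] at hp ⊢
    rw [(hcond J y d).1, (hcond J y d).2]
    exact hp.2
  · rintro ⟨y, d, J⟩ hp ⟨y', d', J'⟩ hp' heq
    simp only [T, Finset.mem_filter, Finset.mem_univ, true_and] at hp hp' heq
    obtain ⟨h1, h2⟩ := Phi_inj _ _ _ _ _ heq
    obtain ⟨h3, h4⟩ := arc_inj hm _ _ _ _ hp.1 hp'.1 h2
    rw [h1, h3, h4]
  · intro σ hσ
    simp only [Finset.mem_filter, Finset.mem_univ, true_and] at hσ
    obtain ⟨x0, hx0⟩ := exists_bad σ _ r (by rw [card_supp hm]; omega) hσ.1 hσ.2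
    obtain ⟨J, y, d, hg, rfl⟩ := decomp σ x0 hx0
    refine ⟨(y, d, J), ?_, rfl⟩
    rw [(hcond J y d).1, (hcond J y d).2] at hσ
    simp only [T, Finset.mem_filter, Finset.mem_univ, true_and]
    exact ⟨hg, hσ⟩

lemma count_card (q k : ℕ) : (Finset.univ.filter fun J : Finset (Fin q) => J.card = k).card
    = q.choose k := by
  have := Fintype.card_finset_len (α := Fin q) k
  rw [Fintype.card_subtype, Fintype.card_fin] at this
  exact this

/-- middle terms -/
def gmid (q r d : ℕ) : ℕ :=
  (Finset.univ.filter fun J : Finset (Fin q) => 2 * J.card + d + 1 = r).card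

lemma count2 {q u r t : ℕ} (hr : q + (u + 2) = r) (ht : r = 2 * t ∨ r = 2 * t + 1) :
    (∑ y : Fin (2*u+2+1), ∑ d : Fin (2*u+2+1), if good y d then
      (Finset.univ.filter fun J : Finset (Fin q) =>
        2 * (q - J.card) + (if d = Fin.last (2*u+2) then 0 else 2*u+2 + 1 - d.val) ≤ r ∧
        2 * J.card + (if d = 0 then 0 else d.val + 1) ≤ r).card else 0)
    = 2 * q.choose t + (2*u+2+1) * ∑ d ∈ Finset.range (2*u+1), gmid q r (d+1) := by
  have hle : ∀ J : Finset (Fin q), J.card ≤ q := fun J => by simpa using Finset.card_le_univ J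
  have hmid : ∀ i : Fin (2*u+1), (Finset.univ.filter fun J : Finset (Fin q) =>
        2 * (q - J.card) + (if (i.castSucc.succ : Fin (2*u+2+1)) = Fin.last (2*u+2) then 0 else 2*u+2 + 1 - (i.castSucc.succ : Fin (2*u+2+1)).val) ≤ r ∧
        2 * J.card + (if (i.castSucc.succ : Fin (2*u+2+1)) = 0 then 0 else (i.castSucc.succ : Fin (2*u+2+1)).val + 1) ≤ r).card = gmid q r (i+1) := by
    intro i
    unfold gmid
    congr 1; ext J
    have := hle J
    have hi := i.2
    have e1 : (i.castSucc.succ : Fin (2*u+2+1)) ≠ Fin.last (2*u+2) := by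
      rw [Fin.ne_iff_vne]; simp; omega
    simp only [Finset.mem_filter, Finset.mem_univ, true_and, e1, if_false, Fin.succ_ne_zero, Fin.val_succ, Fin.val_castSucc]
    omega
  have h0 : (Finset.univ.filter fun J : Finset (Fin q) =>
        2 * (q - J.card) + (if (0 : Fin (2*u+2+1)) = Fin.last (2*u+2) then 0 else 2*u+2 + 1 - (0 : Fin (2*u+2+1)).val) ≤ r ∧
        2 * J.card + (if (0 : Fin (2*u+2+1)) = 0 then 0 else (0 : Fin (2*u+2+1)).val + 1) ≤ r).card = q.choose t := by
    rw [← count_card]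
    congr 1; ext J
    have := hle J
    have e1 : (0 : Fin (2*u+2+1)) ≠ Fin.last (2*u+2) := by
      rw [Fin.ne_iff_vne]; simp
    simp only [Finset.mem_filter, Finset.mem_univ, true_and, e1, if_false, if_true, Fin.val_zero]
    omega
  have hl : (Finset.univ.filter fun J : Finset (Fin q) =>
        2 * (q - J.card) + (if Fin.last (2*u+2) = Fin.last (2*u+2) then 0 else 2*u+2 + 1 - (Fin.last (2*u+2)).val) ≤ r ∧
        2 * J.card + (if Fin.last (2*u+2) = 0 then 0 else (Fin.last (2*u+2)).val + 1) ≤ r).card = q.choose t := by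
    have e1 : Fin.last (2*u+2) ≠ 0 := by
      rw [Fin.ne_iff_vne]; simp
    by_cases hq : t ≤ q
    · rw [← Nat.choose_symm hq, ← count_card]
      congr 1; ext J
      have := hle J
      simp only [Finset.mem_filter, Finset.mem_univ, true_and, e1, if_false, if_true, Fin.val_last]
      omega
    · rw [Nat.choose_eq_zero_of_lt (by omega), Finset.card_eq_zero]
      ext J
      have := hle J
      simp only [Finset.mem_filter, Finset.mem_univ, true_and, e1, if_false, if_true, Fin.val_last, Finset.notMem_empty, iff_false]
      omega
  have g0 : ∀ y : Fin (2*u+2+1), good y 0 ↔ y = 0 := by intro y; simp [good]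
  have gl : ∀ y : Fin (2*u+2+1), good y (Fin.last (2*u+2)) ↔ y = 0 := by intro y; simp [good]
  have gm : ∀ (y : Fin (2*u+2+1)) (i : Fin (2*u+1)), good y (i.castSucc.succ : Fin (2*u+2+1)) := by
    intro y i h
    exfalso
    have hi := i.2
    rcases h with h | h
    · exact Fin.succ_ne_zero _ h
    · have := congrArg Fin.val h
      simp at this; omega
  have key : ∀ F : Fin (2*u+2+1) → ℕ, ∑ d, F d =
      F 0 + (∑ i : Fin (2*u+1), F i.castSucc.succ + F (Fin.last (2*u+2))) := by
    intro F
    rw [Fin.sum_univ_succ, Fin.sum_univ_castSucc, Fin.succ_last]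
  have gen : ∀ N : Fin (2*u+2+1) → ℕ, (∑ y : Fin (2*u+2+1), ∑ d : Fin (2*u+2+1),
      if good y d then N d else 0) =
      N 0 + ((2*u+2+1) * ∑ i : Fin (2*u+1), N i.castSucc.succ + N (Fin.last (2*u+2))) := by
    intro N
    rw [Finset.sum_comm, key]
    simp only [gm, if_true, g0, gl, Finset.sum_ite_eq', Finset.mem_univ, Finset.sum_const,
      Finset.card_univ, Fintype.card_fin, smul_eq_mul, Finset.mul_sum]
  rw [gen]
  beta_reduce
  rw [h0, hl, Finset.sum_congr rfl fun i _ => hmid i,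
    Fin.sum_univ_eq_sum_range (fun i => gmid q r (i+1))]
  ring

lemma gmid_good (q r t d i : ℕ) (h : d + 1 + 2 * t = r + 2 * i) :
    gmid q r d = if i ≤ t then q.choose (t - i) else 0 := by
  unfold gmid
  split_ifs with hi
  · rw [← count_card]; congr 1; ext J
    simp only [Finset.mem_filter, Finset.mem_univ, true_and]; omega
  · rw [Finset.card_eq_zero]; ext J
    simp only [Finset.mem_filter, Finset.mem_univ, true_and, Finset.notMem_empty, iff_false]; omega

lemma gmid_zero (q r d : ℕ) (h : (d + r) % 2 = 0) : gmid q r d = 0 := by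
  unfold gmid
  rw [Finset.card_eq_zero]; ext J
  simp only [Finset.mem_filter, Finset.mem_univ, true_and, Finset.notMem_empty, iff_false]; omega

lemma mid_even (q t u : ℕ) : ∑ d ∈ Finset.range (2*u+1), gmid q (2*t) (d+1) =
    ∑ i ∈ Finset.Icc 1 (u+1), if i ≤ t then q.choose (t - i) else 0 := by
  induction u with
  | zero => simp [gmid_good q (2*t) t 1 1 (by omega)]
  | succ u ih =>
    rw [show 2*(u+1)+1 = 2*u+1+1+1 by ring, Finset.sum_range_succ, Finset.sum_range_succ, ih,
      Finset.sum_Icc_succ_top (show 1 ≤ u+1+1 by omega), gmid_zero _ _ (2*u+1+1) (by omega),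
      gmid_good q (2*t) t (2*u+1+1+1) (u+1+1) (by omega), add_zero]

lemma mid_odd (q t u : ℕ) : ∑ d ∈ Finset.range (2*u+1), gmid q (2*t+1) (d+1) =
    ∑ i ∈ Finset.Icc 1 u, if i ≤ t then q.choose (t - i) else 0 := by
  induction u with
  | zero => simp [gmid_zero q (2*t+1) 1 (by omega)]
  | succ u ih =>
    rw [show 2*(u+1)+1 = 2*u+1+1+1 by ring, Finset.sum_range_succ, Finset.sum_range_succ, ih,
      Finset.sum_Icc_succ_top (by omega), gmid_zero _ _ (2*u+1+1+1) (by omega),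
      gmid_good q (2*t+1) t (2*u+1+1) (u+1) (by omega), add_zero]

lemma cycleType_inl {α β : Type*} [Fintype α] [Fintype β] [DecidableEq α] [DecidableEq β]
    (a : Perm α) : Equiv.Perm.cycleType (Equiv.sumCongr a (1 : Perm β) : Perm (α ⊕ β)) = a.cycleType := by
  classical
  rw [← cycleType_extendDomain (Equiv.ofInjective (Sum.inl : α → α ⊕ β) Sum.inl_injective) (g := a)]
  congr 1
  ext1 x
  rcases x with x | x
  · have := extendDomain_apply_image a
      (Equiv.ofInjective (Sum.inl : α → α ⊕ β) Sum.inl_injective) x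
    simp only [Equiv.ofInjective_apply] at this
    rw [this]; simp
  · rw [extendDomain_apply_not_subtype _ _ (by simp)]; simp

lemma cycleType_inr {α β : Type*} [Fintype α] [Fintype β] [DecidableEq α] [DecidableEq β]
    (a : Perm β) : Equiv.Perm.cycleType (Equiv.sumCongr (1 : Perm α) a : Perm (α ⊕ β)) = a.cycleType := by
  classical
  rw [← cycleType_extendDomain (Equiv.ofInjective (Sum.inr : β → α ⊕ β) Sum.inr_injective) (g := a)]
  congr 1
  ext1 x
  rcases x with x | x
  · rw [extendDomain_apply_not_subtype _ _ (by simp)]; simp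
  · have := extendDomain_apply_image a
      (Equiv.ofInjective (Sum.inr : β → α ⊕ β) Sum.inr_injective) x
    simp only [Equiv.ofInjective_apply] at this
    rw [this]; simp

lemma cycleType_sumCongr' {α β : Type*} [Fintype α] [Fintype β] [DecidableEq α] [DecidableEq β]
    (a : Perm α) (b : Perm β) :
    Equiv.Perm.cycleType (Equiv.sumCongr a b : Perm (α ⊕ β)) = a.cycleType + b.cycleType := by
  have h : (Equiv.sumCongr a b : Perm (α ⊕ β)) =
      (Equiv.sumCongr a (1 : Perm β)) * (Equiv.sumCongr (1 : Perm α) b) := by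
    ext1 x; rcases x with x | x <;> simp
  rw [h, Disjoint.cycleType_mul, cycleType_inl, cycleType_inr]
  rintro (x | x)
  · right; simp
  · left; simp

lemma cycleType_permCongr' {α β : Type*} [Fintype α] [Fintype β] [DecidableEq α] [DecidableEq β]
    (f : α ≃ β) (a : Perm α) : (f.permCongr a).cycleType = a.cycleType := by
  classical
  rw [← cycleType_extendDomain (f.trans (Equiv.subtypeUnivEquiv (p := fun _ : β => True) (fun _ => trivial)).symm) (g := a)]
  congr 1

lemma cycleType_flip (q : ℕ) :
    (flipP (Finset.univ : Finset (Fin q))).cycleType = Multiset.replicate q 2 := by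
  have h2 : flipP (Finset.univ : Finset (Fin q)) ^ 2 = 1 := by
    ext x <;> simp [flipP, pow_two]
  have : Fact (Nat.Prime 2) := ⟨Nat.prime_two⟩
  have h3 := pow_prime_eq_one_iff.1 h2
  have h4 := Multiset.eq_replicate_card.2 h3
  have hs : (flipP (Finset.univ : Finset (Fin q))).support = Finset.univ := by
    ext x; rcases x with ⟨i, b⟩; simp [flipP]
  have h5 := sum_cycleType (flipP (Finset.univ : Finset (Fin q)))
  rw [hs, h4] at h5
  simp at h5
  rw [h4, h5]

/-- Let `t ≥ 2`, `r = 2t` or `r = 2t + 1`, `2 ≤ s ≤ r`, `ℓ = 2s - 1`, and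
`n ≥ 2r - 1`. Then there is a permutation `π` of `Fin n` whose cycle type consists of
`r - s` parts equal to `2` and one part equal to `ℓ` (so `|support π| = 2r - 1`) such
that `|B_r(π) ∩ B_r(1)| = 2·C(r-s, t) + ℓ · Σ_{i=1}^{s-1} C(r-s, t-i)` if `r = 2t`, and
`|B_r(π) ∩ B_r(1)| = 2·C(r-s, t) + ℓ · Σ_{i=1}^{s-2} C(r-s, t-i)` if `r = 2t + 1`
(terms with `i > t`, i.e. negative lower index, are `0`, handled by the guard
`i ≤ t`). -/
theorem stmt15 (n t r s : ℕ) (ht : 2 ≤ t) (hr : r = 2 * t ∨ r = 2 * t + 1)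
    (hs2 : 2 ≤ s) (hsr : s ≤ r) (hn : 2 * r - 1 ≤ n) :
    ∃ π : Equiv.Perm (Fin n),
      π.support.card = 2 * r - 1 ∧
      π.cycleType = Multiset.replicate (r - s) 2 + {2 * s - 1} ∧
      (pball π r ∩ pball 1 r).card =
        2 * Nat.choose (r - s) t +
          (2 * s - 1) *
            (if r = 2 * t then
              ∑ i ∈ Finset.Icc 1 (s - 1),
                (if i ≤ t then Nat.choose (r - s) (t - i) else 0)
            else
              ∑ i ∈ Finset.Icc 1 (s - 2),
                (if i ≤ t then Nat.choose (r - s) (t - i) else 0)) := by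
  obtain ⟨u, rfl⟩ : ∃ u, s = u + 2 := ⟨s - 2, by omega⟩
  obtain ⟨q, hq⟩ : ∃ q, q + (u + 2) = r := ⟨r - (u + 2), by omega⟩
  obtain ⟨e, he⟩ : ∃ e, n = 2 * r - 1 + e := ⟨n - (2 * r - 1), by omega⟩
  have hcard : Fintype.card (XX q (2*u+2) e) = n := by
    simp [XX]; omega
  let f : XX q (2*u+2) e ≃ Fin n := Fintype.equivFinOfCardEq hcard
  let π0 : Equiv.Perm (XX q (2*u+2) e) := Phi e Finset.univ (finRotate (2*u+2+1))
  have hrq : r - (u + 2) = q := by omega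
  have hl : 2 * (u + 2) - 1 = 2 * u + 2 + 1 := by omega
  have hct : (f.permCongr π0).cycleType
      = Multiset.replicate (r - (u + 2)) 2 + {2 * (u + 2) - 1} := by
    rw [cycleType_permCongr', hrq, hl]
    simp only [π0, Phi]
    rw [cycleType_sumCongr', cycleType_sumCongr', cycleType_flip,
      cycleType_finRotate_of_le (by omega)]
    simp
  refine ⟨f.permCongr π0, ?_, hct, ?_⟩
  · rw [← Equiv.Perm.sum_cycleType, hct]
    simp; omega
  · have hdeq : ∀ a b : Equiv.Perm (XX q (2*u+2) e),
        hdist (f.permCongr a) (f.permCongr b) = hd a b := by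
      intro a b
      unfold hdist hd
      symm
      apply Finset.card_bij (fun x _ => f x)
      · intro x; simp
      · intro x _ y _ h; exact f.injective h
      · intro x hx
        refine ⟨f.symm x, ?_, by simp⟩
        simpa using hx
    have h1 : f.permCongr 1 = 1 := by ext x; simp
    have hball : (pball (f.permCongr π0) r ∩ pball 1 r).card =
        (Finset.univ.filter fun σ : Equiv.Perm (XX q (2*u+2) e) =>
          hd π0 σ ≤ r ∧ hd 1 σ ≤ r).card := by
      symm
      apply Finset.card_bij (fun σ _ => f.permCongr σ)
      · intro σ hσ
        simp only [Finset.mem_filter, Finset.mem_univ, true_and] at hσ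
        simp only [pball, Finset.mem_inter, Finset.mem_filter, Finset.mem_univ, true_and]
        rw [hdeq, ← h1, hdeq]; exact hσ
      · intro a _ b _ h; exact f.permCongr.injective h
      · intro τ hτ
        obtain ⟨σ, rfl⟩ := f.permCongr.surjective τ
        refine ⟨σ, ?_, rfl⟩
        simp only [pball, Finset.mem_inter, Finset.mem_filter, Finset.mem_univ, true_and] at hτ
        rw [hdeq, ← h1, hdeq] at hτ
        simpa using hτ
    rw [hball, count1 (by omega) (by omega), count2 hq hr, hrq, hl]
    congr 2
    rcases hr with h | h
    · rw [if_pos h, h, mid_even]; rfl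
    · rw [if_neg (by omega), h, mid_odd]; rfl
end

section
/- Let t ≥ 2, let r = 2t or r = 2t + 1, and let n ≥ 2r − 1. For each ℓ with 3 ≤ ℓ ≤ 2r − 1, let π_ℓ be any permutation of Fin n whose cycle type is: (r − s) parts equal to 2 together with one part equal to ℓ, if ℓ = 2s − 1 is odd; and (r − s − 2) parts equal to 2, one part equal to 3 and one part equal to ℓ, if ℓ = 2s is even (in both cases |support π_ℓ| = 2r − 1). Then the maximum over 3 ≤ ℓ ≤ 2r − 1 of |B_r(π_ℓ) ∩ B_r(1)| equals 2·C(2t−3, t) + ℓ*·C(2t−2, t−1), where ℓ* = 5 if r = 2t and ℓ* = 7 if r = 2t + 1; moreover the maximum is attained at ℓ = ℓ*. -/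
namespace Stmt16
open Equiv Equiv.Perm

/-- the cycle running through `m` consecutive points of a cycle of `π` starting at `y` -/
def arc {n : ℕ} (π : Perm (Fin n)) (y : Fin n) (m : ℕ) : Perm (Fin n) :=
  (List.iterate π y m).formPerm

/-- total number of points moved by a family of cycles -/
def wt {n : ℕ} (S : Finset (Perm (Fin n))) : ℕ := ∑ c ∈ S, c.support.card

variable {n : ℕ} (π : Perm (Fin n))

lemma iter_inj (y : Fin n) (i j : ℕ) (hi : i < (π.cycleOf y).support.card)
    (hj : j < (π.cycleOf y).support.card) (h : π^[i] y = π^[j] y) : i = j := by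
  have hnd := nodup_toList π y
  rw [List.nodup_iff_injective_getElem] at hnd
  have := @hnd ⟨i, by simpa using hi⟩ ⟨j, by simpa using hj⟩ (by simpa [toList] using h)
  simpa using this

lemma iter_nodup (y : Fin n) (m : ℕ) (hm : m ≤ (π.cycleOf y).support.card) :
    (List.iterate π y m).Nodup := by
  rw [List.nodup_iff_injective_getElem]
  rintro ⟨i, hi⟩ ⟨j, hj⟩ h
  simp only [List.length_iterate] at hi hj
  simp only [List.getElem_iterate] at h
  have := iter_inj π y i j (by omega) (by omega) h
  simpa using this

lemma arc_isCycle (y : Fin n) (m : ℕ) (h2 : 2 ≤ m) (hm : m ≤ (π.cycleOf y).support.card) :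
    (arc π y m).IsCycle :=
  List.isCycle_formPerm (iter_nodup π y m hm) (by simpa using h2)

lemma arc_support (y : Fin n) (m : ℕ) (h2 : 2 ≤ m) (hm : m ≤ (π.cycleOf y).support.card) :
    (arc π y m).support = (List.iterate π y m).toFinset :=
  List.support_formPerm_of_nodup _ (iter_nodup π y m hm) (by
    intro x hx
    have := congrArg List.length hx
    simp at this
    omega)

lemma mem_arc_support (y : Fin n) (m : ℕ) (h2 : 2 ≤ m) (hm : m ≤ (π.cycleOf y).support.card)
    (a : Fin n) : a ∈ (arc π y m).support ↔ ∃ i < m, π^[i] y = a := by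
  rw [arc_support π y m h2 hm, List.mem_toFinset, List.mem_iterate]
  simp [eq_comm]

lemma arc_card (y : Fin n) (m : ℕ) (h2 : 2 ≤ m) (hm : m ≤ (π.cycleOf y).support.card) :
    (arc π y m).support.card = m := by
  rw [arc_support π y m h2 hm, List.toFinset_card_of_nodup (iter_nodup π y m hm)]
  simp

lemma arc_apply_lt (y : Fin n) (m : ℕ) (hm : m ≤ (π.cycleOf y).support.card)
    (i : ℕ) (hi : i + 1 < m) : arc π y m (π^[i] y) = π (π^[i] y) := by
  have := List.formPerm_apply_lt_getElem _ (iter_nodup π y m hm) i (by simpa using hi)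
  simp only [List.getElem_iterate] at this
  rw [arc, this, Function.iterate_succ_apply']

lemma arc_apply_last (y : Fin n) (m : ℕ) (h1 : 1 ≤ m) (hm : m ≤ (π.cycleOf y).support.card) :
    arc π y m (π^[m-1] y) = y := by
  have := List.formPerm_apply_getElem _ (iter_nodup π y m hm) (m-1) (by simp; omega)
  simp only [List.getElem_iterate, List.length_iterate] at this
  rw [arc, this, Nat.sub_add_cancel h1]
  simp

/-- The unique point where the arc disagrees with `π`. -/
lemma arc_bad (y : Fin n) (m : ℕ) (h2 : 2 ≤ m) (hm : m < (π.cycleOf y).support.card)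
    (a : Fin n) (ha : a ∈ (arc π y m).support) :
    arc π y m a ≠ π a ↔ a = π^[m-1] y := by
  obtain ⟨i, hi, rfl⟩ := (mem_arc_support π y m h2 hm.le a).1 ha
  constructor
  · intro h
    by_cases h' : i + 1 < m
    · exact absurd (arc_apply_lt π y m hm.le i h') h
    · congr 1
      have : i = m - 1 := by omega
      rw [this]
  · intro h
    rw [h, arc_apply_last π y m (by omega) hm.le, ← Function.iterate_succ_apply' (f := π)]
    intro h3
    have := iter_inj π y 0 (m-1+1) (by omega) (by omega) (by simpa using h3)
    omega

lemma arc_support_le (y : Fin n) (m : ℕ) (h2 : 2 ≤ m) (hm : m ≤ (π.cycleOf y).support.card) :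
    (arc π y m).support ⊆ (π.cycleOf y).support := by
  intro a ha
  obtain ⟨i, hi, rfl⟩ := (mem_arc_support π y m h2 hm a).1 ha
  have hy : y ∈ π.support := by
    by_contra hy
    rw [notMem_support, ← cycleOf_eq_one_iff] at hy
    rw [hy] at hm
    simp at hm
    omega
  rw [mem_support_cycleOf_iff]
  refine ⟨⟨i, ?_⟩, hy⟩
  rw [zpow_natCast, Perm.iterate_eq_pow]

lemma arc_notMem (y : Fin n) (m : ℕ) (h2 : 2 ≤ m) (hm : m < (π.cycleOf y).support.card) :
    arc π y m ∉ π.cycleFactorsFinset := by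
  intro h
  have hmem : π^[m-1] y ∈ (arc π y m).support :=
    (mem_arc_support π y m h2 hm.le _).2 ⟨m-1, by omega, rfl⟩
  exact (arc_bad π y m h2 hm _ hmem).2 rfl ((mem_cycleFactorsFinset_iff.1 h).2 _ hmem)

lemma arc_inj (y y' : Fin n) (m m' : ℕ) (h2 : 2 ≤ m) (hm : m < (π.cycleOf y).support.card)
    (h2' : 2 ≤ m') (hm' : m' < (π.cycleOf y').support.card) (h : arc π y m = arc π y' m') :
    y = y' := by
  have hmem : π^[m-1] y ∈ (arc π y m).support :=
    (mem_arc_support π y m h2 hm.le _).2 ⟨m-1, by omega, rfl⟩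
  have hb := (arc_bad π y m h2 hm _ hmem).2 rfl
  have hl := arc_apply_last π y m (by omega) hm.le
  rw [h] at hmem hb hl
  rw [arc_bad π y' m' h2' hm' _ hmem] at hb
  rw [hb, arc_apply_last π y' m' (by omega) hm'.le] at hl
  exact hl.symm

lemma exists_of_cycles (S : Finset (Perm (Fin n))) (h1 : ∀ c ∈ S, c.IsCycle)
    (h2 : ∀ c ∈ S, ∀ d ∈ S, c ≠ d → Perm.Disjoint c d) :
    ∃ σ : Perm (Fin n), σ.cycleFactorsFinset = S := by
  have h : (S : Set (Perm (Fin n))).Pairwise Perm.Disjoint := fun c hc d hd hcd => h2 c hc d hd hcd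
  exact ⟨_, cycleFactorsFinset_eq_finset.2 ⟨h1, h, rfl⟩⟩

lemma wt_cff (σ : Perm (Fin n)) : wt σ.cycleFactorsFinset = σ.support.card := by
  rw [← sum_cycleType, cycleType_def, wt, Finset.sum]
  rfl

lemma good_iff (σ : Perm (Fin n)) : (∀ i, σ i = i ∨ σ i = π i) ↔
    σ.cycleFactorsFinset ⊆ π.cycleFactorsFinset := by
  constructor
  · intro h c hc
    rw [mem_cycleFactorsFinset_iff] at hc ⊢
    refine ⟨hc.1, fun a ha => ?_⟩
    rw [hc.2 a ha]
    refine (h a).resolve_left ?_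
    rw [← hc.2 a ha]
    exact mem_support.1 ha
  · intro h i
    by_cases hi : i ∈ σ.support
    · have h1 := (mem_cycleFactorsFinset_iff.1 (h (cycleOf_mem_cycleFactorsFinset_iff.2 hi))).2 i
        (mem_support_cycleOf_iff.2 ⟨SameCycle.refl _ _, hi⟩)
      rw [cycleOf_apply_self] at h1
      exact Or.inr h1
    · exact Or.inl (notMem_support.1 hi)

/-- set of bad positions -/
def badS (σ : Perm (Fin n)) : Finset (Fin n) := Finset.univ.filter fun i => σ i ≠ i ∧ σ i ≠ π i

lemma hdist_one (σ : Perm (Fin n)) : hdist 1 σ = σ.support.card := by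
  unfold hdist
  congr 1
  ext i
  rw [Finset.mem_filter, mem_support, Perm.one_apply]
  exact ⟨fun h => h.2.symm, fun h => ⟨Finset.mem_univ _, h.symm⟩⟩

lemma hdist_sum (σ : Perm (Fin n)) : σ.support.card + hdist π σ =
    π.support.card + (badS π σ).card + ((badS π σ).filter (fun i => i ∉ π.support)).card := by
  have e : σ.support = Finset.univ.filter (fun i => σ i ≠ i) := by ext; simp
  have e' : π.support = Finset.univ.filter (fun i => π i ≠ i) := by ext; simp
  rw [hdist, badS, Finset.filter_filter, e, e']
  simp only [Finset.card_filter, ← Finset.sum_add_distrib]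
  refine Finset.sum_congr rfl fun i _ => ?_
  by_cases h1 : σ i = i <;> by_cases h2 : π i = i <;> by_cases h3 : σ i = π i <;>
    grind

lemma mem_G (r : ℕ) (σ : Perm (Fin n)) :
    σ ∈ pball π r ∩ pball 1 r ↔ hdist π σ ≤ r ∧ σ.support.card ≤ r := by
  simp [pball, hdist_one]

lemma badS_empty_iff (σ : Perm (Fin n)) : badS π σ = ∅ ↔
    σ.cycleFactorsFinset ⊆ π.cycleFactorsFinset := by
  rw [← good_iff, badS, Finset.filter_eq_empty_iff]
  refine ⟨fun h i => ?_, fun h i _ => ?_⟩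
  · have := h (Finset.mem_univ i)
    tauto
  · have := h i
    tauto

lemma G0_card (r : ℕ) (hπ : π.support.card + 1 = 2 * r) :
    ((pball π r ∩ pball 1 r).filter (fun σ => badS π σ = ∅)).card =
      (π.cycleFactorsFinset.powerset.filter (fun S => wt S ≤ r ∧ r ≤ wt S + 1)).card := by
  refine Finset.card_bij (fun σ _ => σ.cycleFactorsFinset) ?_ ?_ ?_
  · intro σ hσ
    rw [Finset.mem_filter, mem_G] at hσ
    have h := hdist_sum π σ
    rw [hσ.2] at h
    simp only [Finset.card_empty, Finset.filter_empty] at h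
    rw [Finset.mem_filter, Finset.mem_powerset, wt_cff, ← badS_empty_iff]
    refine ⟨hσ.2, by omega, by omega⟩
  · intro σ _ τ _ h
    exact cycleFactorsFinset_injective h
  · intro S hS
    rw [Finset.mem_filter, Finset.mem_powerset] at hS
    obtain ⟨σ, hσ⟩ := exists_of_cycles S
      (fun c hc => (mem_cycleFactorsFinset_iff.1 (hS.1 hc)).1)
      (fun c hc d hd hcd => cycleFactorsFinset_pairwise_disjoint π (hS.1 hc) (hS.1 hd) hcd)
    refine ⟨σ, ?_, hσ⟩
    have hb : badS π σ = ∅ := by rw [badS_empty_iff, hσ]; exact hS.1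
    have h := hdist_sum π σ
    rw [hb] at h
    simp only [Finset.card_empty, Finset.filter_empty] at h
    rw [← hσ, wt_cff] at hS
    rw [Finset.mem_filter, mem_G]
    refine ⟨⟨by omega, by omega⟩, hb⟩

lemma iter_succ_ne (σ : Perm (Fin n)) (j : Fin n) (i : ℕ)
    (hi : i + 1 < (σ.cycleOf j).support.card) : σ^[i] (σ j) ≠ j := by
  intro h
  rw [← Function.iterate_succ_apply (f := σ)] at h
  have := iter_inj σ j (i+1) 0 hi (by omega) (by simpa using h)
  omega

lemma iter_mem_support (σ : Perm (Fin n)) (j : Fin n) (hj : σ j ≠ j) (i : ℕ) :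
    σ (σ^[i] j) ≠ σ^[i] j := by
  induction i with
  | zero => simpa using hj
  | succ i ih =>
    rw [Function.iterate_succ_apply']
    intro h
    exact ih (σ.injective h)

lemma iter_eq (σ : Perm (Fin n)) (j : Fin n) (hj : badS π σ = {j}) (i : ℕ)
    (hi : i < (σ.cycleOf j).support.card) : σ^[i] (σ j) = π^[i] (σ j) := by
  have hjb : j ∈ badS π σ := by rw [hj]; simp
  simp only [badS, Finset.mem_filter, Finset.mem_univ, true_and] at hjb
  induction i with
  | zero => rfl
  | succ i ih =>
    have ih := ih (by omega)
    have hne := iter_succ_ne σ j i hi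
    have h1 := iter_mem_support σ j hjb.1 (i+1)
    rw [Function.iterate_succ_apply] at h1
    have h2 : σ^[i] (σ j) ∉ badS π σ := by rw [hj]; simpa using hne
    simp only [badS, Finset.mem_filter, Finset.mem_univ, true_and, not_and, not_not] at h2
    rw [Function.iterate_succ_apply', Function.iterate_succ_apply', h2 h1, ih]

lemma G1_forward (r : ℕ) (hπ : π.support.card + 1 = 2 * r) (σ : Perm (Fin n))
    (hσ : σ ∈ pball π r ∩ pball 1 r) (hb : badS π σ ≠ ∅) :
    ∃ y ∈ π.support, ∃ S ⊆ π.cycleFactorsFinset.erase (π.cycleOf y),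
      wt S + 2 ≤ r ∧ r + 1 ≤ wt S + (π.cycleOf y).support.card ∧
      σ.cycleFactorsFinset = insert (arc π y (r - wt S)) S := by
  rw [mem_G] at hσ
  have hsum := hdist_sum π σ
  have hpos : 0 < (badS π σ).card := Finset.card_pos.2 (Finset.nonempty_iff_ne_empty.2 hb)
  have hone : (badS π σ).card = 1 := by omega
  have hr : σ.support.card = r := by omega
  obtain ⟨j, hj⟩ := Finset.card_eq_one.1 hone
  have hjb : j ∈ badS π σ := by rw [hj]; simp
  simp only [badS, Finset.mem_filter, Finset.mem_univ, true_and] at hjb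
  have hgood : ∀ a, a ≠ j → σ a ≠ a → σ a = π a := by
    intro a ha h
    have h2 : a ∉ badS π σ := by rw [hj]; simpa using ha
    simp only [badS, Finset.mem_filter, Finset.mem_univ, true_and, not_and, not_not] at h2
    exact h2 h
  have hjs : j ∈ σ.support := mem_support.2 hjb.1
  set d := σ.cycleOf j with hd
  set m := d.support.card with hm
  have hdc : d.IsCycle := isCycle_cycleOf σ hjb.1
  have h2m : 2 ≤ m := hdc.two_le_card_support
  have hdm : d ∈ σ.cycleFactorsFinset := cycleOf_mem_cycleFactorsFinset_iff.2 hjs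
  set y := σ j with hy
  have hyd : σ.cycleOf y = d := by
    rw [hy, hd]; exact cycleOf_self_apply σ j
  have hys : σ y ≠ y := fun h => hjb.1 (σ.injective h)
  have hymem : y ∈ d.support := by
    rw [← hyd, mem_support_cycleOf_iff]
    exact ⟨SameCycle.refl _ _, mem_support.2 hys⟩
  have hyπ : y ∈ π.support := by
    rw [mem_support, ← hgood y hjb.1 hys]
    exact hys
  have hdarc : d = arc π y m := by
    rw [← hyd, ← formPerm_toList, toList, hyd, arc]
    congr 1
    refine List.ext_getElem (by simp [hm]) fun i h1 h2 => ?_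
    simp only [List.length_iterate] at h1
    simp only [List.getElem_iterate]
    exact iter_eq π σ j hj i h1
  have hsub : d.support ⊆ (π.cycleOf y).support := by
    intro a ha
    rw [← hyd, mem_support_cycleOf_iff] at ha
    obtain ⟨i, hi, rfl⟩ := ha.1.exists_pow_eq_of_mem_support ha.2
    rw [hyd] at hi
    rw [mem_support_cycleOf_iff]
    refine ⟨⟨i, ?_⟩, hyπ⟩
    rw [zpow_natCast, ← Perm.iterate_eq_pow, ← Perm.iterate_eq_pow]
    exact (iter_eq π σ j hj i hi).symm
  have hmle : m ≤ (π.cycleOf y).support.card := Finset.card_le_card hsub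
  have hmlt : m < (π.cycleOf y).support.card := by
    refine lt_of_le_of_ne hmle fun h => ?_
    have hbad := arc_apply_last π y m (by omega) hmle
    have h3 := iter_eq π σ j hj (m-1) (show m - 1 < m by omega)
    have h4 : σ^[m-1] (σ j) = j := by
      have h5 : arc π y m j = y := by
        rw [← hdarc, hd, cycleOf_apply_self]
      rw [← hy] at h3
      rw [← h3] at hbad
      rw [← hy]
      exact (arc π y m).injective (hbad.trans h5.symm)
    have h6 : π^[m] y = y := by
      rw [h, Perm.iterate_eq_pow]
      have := pow_mod_card_support_cycleOf_self_apply π (π.cycleOf y).support.card y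
      rw [Nat.mod_self] at this
      rw [← this]; simp
    have h7 : m = (m - 1) + 1 := by omega
    rw [h7, Function.iterate_succ_apply', ← h3, h4] at h6
    exact hjb.2 h6.symm
  have hwt : wt (σ.cycleFactorsFinset.erase d) + m = r := by
    rw [← hr, ← wt_cff, wt, wt, hm, Finset.sum_erase_add _ _ hdm]
  refine ⟨y, hyπ, σ.cycleFactorsFinset.erase d, ?_, by omega, by omega, ?_⟩
  · intro e he
    rw [Finset.mem_erase] at he
    have hdis := cycleFactorsFinset_pairwise_disjoint σ he.2 hdm he.1
    rw [disjoint_iff_disjoint_support, Finset.disjoint_left] at hdis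
    have he' := mem_cycleFactorsFinset_iff.1 he.2
    rw [Finset.mem_erase, mem_cycleFactorsFinset_iff]
    refine ⟨?_, he'.1, fun a ha => ?_⟩
    · rintro rfl
      exact hdis (hsub hymem) hymem
    · rw [he'.2 a ha]
      refine hgood a ?_ ?_
      · rintro rfl
        exact hdis ha (mem_support_cycleOf_iff.2 ⟨SameCycle.refl _ _, hjs⟩)
      · rw [← he'.2 a ha]; exact mem_support.1 ha
  · have : r - wt (σ.cycleFactorsFinset.erase d) = m := by omega
    rw [this, ← hdarc, Finset.insert_erase hdm]

lemma G1_backward (r : ℕ) (hπ : π.support.card + 1 = 2 * r) (y : Fin n) (hy : y ∈ π.support)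
    (S : Finset (Perm (Fin n))) (hS : S ⊆ π.cycleFactorsFinset.erase (π.cycleOf y))
    (h1 : wt S + 2 ≤ r) (h2 : r + 1 ≤ wt S + (π.cycleOf y).support.card) :
    ∃ σ, σ ∈ (pball π r ∩ pball 1 r).filter (fun σ => ¬ badS π σ = ∅) ∧
      σ.cycleFactorsFinset = insert (arc π y (r - wt S)) S := by
  set m := r - wt S with hm
  have h2m : 2 ≤ m := by omega
  have hmlt : m < (π.cycleOf y).support.card := by omega
  have hS' : ∀ c ∈ S, c ∈ π.cycleFactorsFinset := fun c hc => Finset.mem_of_mem_erase (hS hc)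
  have harc := arc_notMem π y m h2m hmlt
  have hnot : arc π y m ∉ S := fun h => harc (hS' _ h)
  have hcyc : π.cycleOf y ∈ π.cycleFactorsFinset := cycleOf_mem_cycleFactorsFinset_iff.2 hy
  have hdis : ∀ c ∈ S, Perm.Disjoint c (arc π y m) := by
    intro c hc
    have h := cycleFactorsFinset_pairwise_disjoint π (hS' c hc) hcyc (Finset.ne_of_mem_erase (hS hc))
    rw [disjoint_iff_disjoint_support] at h ⊢
    exact h.mono_right (arc_support_le π y m h2m hmlt.le)
  obtain ⟨σ, hσ⟩ := exists_of_cycles (insert (arc π y m) S)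
    (by
      intro c hc
      rcases Finset.mem_insert.1 hc with rfl | hc
      · exact arc_isCycle π y m h2m hmlt.le
      · exact (mem_cycleFactorsFinset_iff.1 (hS' c hc)).1)
    (by
      intro c hc d hd hcd
      rcases Finset.mem_insert.1 hc with rfl | hc <;> rcases Finset.mem_insert.1 hd with rfl | hd
      · exact absurd rfl hcd
      · exact (hdis d hd).symm
      · exact hdis c hc
      · exact cycleFactorsFinset_pairwise_disjoint π (hS' c hc) (hS' d hd) hcd)
  refine ⟨σ, ?_, hσ⟩
  have hw : σ.support.card = r := by
    rw [← wt_cff, hσ, wt, Finset.sum_insert hnot, arc_card π y m h2m hmlt.le, ← wt]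
    omega
  have hemem : π^[m-1] y ∈ (arc π y m).support :=
    (mem_arc_support π y m h2m hmlt.le _).2 ⟨m-1, by omega, rfl⟩
  have harcσ : arc π y m ∈ σ.cycleFactorsFinset := by rw [hσ]; exact Finset.mem_insert_self _ _
  have hval := (mem_cycleFactorsFinset_iff.1 harcσ).2
  have hbad : badS π σ = {π^[m-1] y} := by
    ext i
    simp only [badS, Finset.mem_filter, Finset.mem_univ, true_and, Finset.mem_singleton]
    constructor
    · rintro ⟨hi1, hi2⟩
      have hi : i ∈ σ.support := mem_support.2 hi1
      have hc := cycleOf_mem_cycleFactorsFinset_iff.2 hi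
      have hci : i ∈ (σ.cycleOf i).support :=
        mem_support_cycleOf_iff.2 ⟨SameCycle.refl _ _, hi⟩
      rw [hσ] at hc
      rcases Finset.mem_insert.1 hc with hc | hc
      · rw [hc] at hci
        rw [← arc_bad π y m h2m hmlt i hci, hval i hci]
        exact hi2
      · have := (mem_cycleFactorsFinset_iff.1 (hS' _ hc)).2 i hci
        rw [cycleOf_apply_self] at this
        exact absurd this hi2
    · rintro rfl
      have := (arc_bad π y m h2m hmlt _ hemem).2 rfl
      rw [hval _ hemem] at this
      refine ⟨?_, this⟩
      rw [← hval _ hemem]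
      exact mem_support.1 hemem
  have hπe : π^[m-1] y ∈ π.support :=
    support_cycleOf_le π y (arc_support_le π y m h2m hmlt.le hemem)
  have hsum := hdist_sum π σ
  rw [hbad] at hsum
  rw [Finset.filter_singleton, if_neg (by simpa using hπe)] at hsum
  simp only [Finset.card_singleton, Finset.card_empty] at hsum
  rw [Finset.mem_filter, mem_G]
  refine ⟨⟨by omega, by omega⟩, ?_⟩
  rw [hbad]
  simp

lemma G1_card (r : ℕ) (hπ : π.support.card + 1 = 2 * r) :
    ((pball π r ∩ pball 1 r).filter (fun σ => ¬ badS π σ = ∅)).card =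
      ∑ y ∈ π.support, ((π.cycleFactorsFinset.erase (π.cycleOf y)).powerset.filter
        (fun S => wt S + 2 ≤ r ∧ r + 1 ≤ wt S + (π.cycleOf y).support.card)).card := by
  rw [← Finset.card_sigma]
  symm
  have key : ∀ x : (Σ _ : Fin n, Finset (Perm (Fin n))),
      x ∈ π.support.sigma (fun y => (π.cycleFactorsFinset.erase (π.cycleOf y)).powerset.filter
        (fun S => wt S + 2 ≤ r ∧ r + 1 ≤ wt S + (π.cycleOf y).support.card)) →
      x.1 ∈ π.support ∧ x.2 ⊆ π.cycleFactorsFinset.erase (π.cycleOf x.1) ∧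
        wt x.2 + 2 ≤ r ∧ r + 1 ≤ wt x.2 + (π.cycleOf x.1).support.card := by
    intro x hx
    rw [Finset.mem_sigma, Finset.mem_filter, Finset.mem_powerset] at hx
    exact hx
  have hex : ∀ x : (Σ _ : Fin n, Finset (Perm (Fin n))), ∀ _ :
      x ∈ π.support.sigma (fun y => (π.cycleFactorsFinset.erase (π.cycleOf y)).powerset.filter
        (fun S => wt S + 2 ≤ r ∧ r + 1 ≤ wt S + (π.cycleOf y).support.card)),
      ∃ σ, σ ∈ (pball π r ∩ pball 1 r).filter (fun σ => ¬ badS π σ = ∅) ∧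
      σ.cycleFactorsFinset = insert (arc π x.1 (r - wt x.2)) x.2 := fun x hx =>
    G1_backward π r hπ x.1 (key x hx).1 x.2 (key x hx).2.1 (key x hx).2.2.1 (key x hx).2.2.2
  choose f hf using hex
  refine Finset.card_bij f (fun x hx => (hf x hx).1) ?_ ?_
  · intro x hx x' hx' h
    have e1 := (hf x hx).2
    have e2 := (hf x' hx').2
    rw [h, e2] at e1
    obtain ⟨k1, k2, k3, k4⟩ := key x hx
    obtain ⟨k1', k2', k3', k4'⟩ := key x' hx'
    have a1 := arc_notMem π x.1 (r - wt x.2) (by omega) (by omega)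
    have a2 := arc_notMem π x'.1 (r - wt x'.2) (by omega) (by omega)
    have s1 : ∀ c ∈ x.2, c ∈ π.cycleFactorsFinset := fun c hc => Finset.mem_of_mem_erase (k2 hc)
    have s2 : ∀ c ∈ x'.2, c ∈ π.cycleFactorsFinset := fun c hc => Finset.mem_of_mem_erase (k2' hc)
    have harc : arc π x.1 (r - wt x.2) = arc π x'.1 (r - wt x'.2) := by
      have : arc π x.1 (r - wt x.2) ∈ insert (arc π x'.1 (r - wt x'.2)) x'.2 := by
        rw [e1]; exact Finset.mem_insert_self _ _
      rcases Finset.mem_insert.1 this with h | h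
      · exact h
      · exact absurd (s2 _ h) a1
    have hS : x.2 = x'.2 := by
      have h1 : x.2 = (insert (arc π x.1 (r - wt x.2)) x.2).erase (arc π x.1 (r - wt x.2)) := by
        rw [Finset.erase_insert (fun h => a1 (s1 _ h))]
      rw [h1, ← e1, harc, Finset.erase_insert (fun h => a2 (s2 _ h))]
    have hy := arc_inj π x.1 x'.1 _ _ (by omega) (by omega) (by omega) (by omega) harc
    cases x; cases x'
    simp only at hS hy
    rw [hS, hy]
  · intro σ hσ
    rw [Finset.mem_filter] at hσ
    obtain ⟨y, hy, S, hS, h1, h2, h3⟩ := G1_forward π r hπ σ hσ.1 hσ.2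
    have hx : (⟨y, S⟩ : (Σ _ : Fin n, Finset (Perm (Fin n)))) ∈
        π.support.sigma (fun y => (π.cycleFactorsFinset.erase (π.cycleOf y)).powerset.filter
        (fun S => wt S + 2 ≤ r ∧ r + 1 ≤ wt S + (π.cycleOf y).support.card)) := by
      rw [Finset.mem_sigma, Finset.mem_filter, Finset.mem_powerset]
      exact ⟨hy, hS, h1, h2⟩
    refine ⟨⟨y, S⟩, hx, cycleFactorsFinset_injective ?_⟩
    rw [(hf _ hx).2, h3]

lemma G_card (r : ℕ) (hπ : π.support.card + 1 = 2 * r) :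
    (pball π r ∩ pball 1 r).card =
      (π.cycleFactorsFinset.powerset.filter (fun S => wt S ≤ r ∧ r ≤ wt S + 1)).card +
      ∑ c ∈ π.cycleFactorsFinset, c.support.card *
       ((π.cycleFactorsFinset.erase c).powerset.filter
        (fun S => wt S + 2 ≤ r ∧ r + 1 ≤ wt S + c.support.card)).card := by
  rw [← Finset.card_filter_add_card_filter_not (fun σ => badS π σ = ∅), G0_card π r hπ,
    G1_card π r hπ]
  congr 1
  rw [← Finset.sum_fiberwise_of_maps_to (t := π.cycleFactorsFinset) (g := fun y => π.cycleOf y)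
    (fun y hy => cycleOf_mem_cycleFactorsFinset_iff.2 hy)]
  refine Finset.sum_congr rfl fun c hc => ?_
  have : π.support.filter (fun y => π.cycleOf y = c) = c.support := by
    ext a
    rw [Finset.mem_filter]
    constructor
    · rintro ⟨h1, rfl⟩
      exact mem_support_cycleOf_iff.2 ⟨SameCycle.refl _ _, h1⟩
    · intro h
      exact ⟨mem_cycleFactorsFinset_support_le hc h, (cycle_is_cycleOf h hc).symm⟩
  rw [this, ← smul_eq_mul, ← Finset.sum_const]
  refine Finset.sum_congr rfl fun y hy => ?_
  rw [← cycle_is_cycleOf hy hc]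

/-- number of subfamilies of `F` whose total weight satisfies `P` -/
noncomputable def W (F : Finset (Perm (Fin n))) (P : ℕ → Prop) : ℕ :=
  open Classical in (F.powerset.filter (fun S => P (wt S))).card

/-- sum of the binomial coefficients `C(k, j)` over the `j` satisfying `P` -/
noncomputable def D (k : ℕ) (P : ℕ → Prop) : ℕ :=
  open Classical in ∑ j ∈ Finset.range (k + 1), if P j then k.choose j else 0

lemma W_eq (F : Finset (Perm (Fin n))) (P : ℕ → Prop) [DecidablePred fun S => P (wt (n := n) S)] :
    (F.powerset.filter (fun S => P (wt S))).card = W F P := by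
  unfold W
  congr

lemma W_insert (c : Perm (Fin n)) (T : Finset (Perm (Fin n))) (hc : c ∉ T) (P : ℕ → Prop) :
    W (insert c T) P = W T P + W T (fun x => P (c.support.card + x)) := by
  classical
  simp only [W, Finset.card_filter]
  rw [Finset.sum_powerset_insert hc]
  congr 1
  refine Finset.sum_congr rfl fun S hS => ?_
  have : c ∉ S := fun h => hc (Finset.mem_powerset.1 hS h)
  have e : wt (insert c S) = c.support.card + wt S := by
    rw [wt, Finset.sum_insert this, ← wt]
  simp only [e]

lemma W_two (T : Finset (Perm (Fin n))) (hT : ∀ c ∈ T, c.support.card = 2) (P : ℕ → Prop) :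
    W T P = D T.card (fun j => P (2 * j)) := by
  classical
  simp only [W, D, Finset.card_filter]
  have h1 := Finset.sum_powerset_apply_card (fun j => if P (2 * j) then 1 else 0) (x := T)
  rw [Finset.sum_congr rfl (g := fun S => if P (2 * S.card) then 1 else 0), h1]
  · refine Finset.sum_congr rfl fun j _ => ?_
    simp
  · intro S hS
    have : wt S = 2 * S.card := by
      rw [wt, Finset.sum_congr rfl (fun c hc => hT c (Finset.mem_powerset.1 hS hc))]
      simp [mul_comm]
    rw [this]

lemma extract (F : Finset (Perm (Fin n))) (a : ℕ) (M : Multiset ℕ)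
    (h : F.1.map (fun c => c.support.card) = a ::ₘ M) :
    ∃ c ∈ F, c.support.card = a ∧ (F.erase c).1.map (fun c => c.support.card) = M := by
  have ha : a ∈ F.1.map (fun c => c.support.card) := by rw [h]; simp
  obtain ⟨c, hc, hca⟩ := Multiset.mem_map.1 ha
  refine ⟨c, hc, hca, ?_⟩
  have hF : F.1 = c ::ₘ (F.erase c).1 := by
    rw [Finset.erase_val, Multiset.cons_erase hc]
  rw [hF, Multiset.map_cons, hca] at h
  exact (Multiset.cons_inj_right a).1 h

lemma twos (F : Finset (Perm (Fin n))) (k : ℕ)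
    (h : F.1.map (fun c => c.support.card) = Multiset.replicate k 2) :
    F.card = k ∧ ∀ c ∈ F, c.support.card = 2 := by
  constructor
  · simpa using congrArg Multiset.card h
  · intro c hc
    have : c.support.card ∈ F.1.map (fun c => c.support.card) := Multiset.mem_map_of_mem _ hc
    rw [h] at this
    exact Multiset.eq_of_mem_replicate this

lemma W_false (F : Finset (Perm (Fin n))) (P : ℕ → Prop) (h : ∀ x, ¬ P x) : W F P = 0 := by
  simp [W, h]

lemma G_card' (r : ℕ) (hπ : π.support.card + 1 = 2 * r) :
    (pball π r ∩ pball 1 r).card =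
      W π.cycleFactorsFinset (fun x => x ≤ r ∧ r ≤ x + 1) +
      ∑ c ∈ π.cycleFactorsFinset, c.support.card *
       W (π.cycleFactorsFinset.erase c) (fun x => x + 2 ≤ r ∧ r + 1 ≤ x + c.support.card) := by
  rw [G_card π r hπ, ← W_eq]
  congr 1
  refine Finset.sum_congr rfl fun c _ => ?_
  rw [← W_eq]

lemma sum_twos (r : ℕ) (F T : Finset (Perm (Fin n))) (hT : ∀ c ∈ T, c.support.card = 2) :
    ∑ c ∈ T, c.support.card *
       W (F.erase c) (fun x => x + 2 ≤ r ∧ r + 1 ≤ x + c.support.card) = 0 := by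
  refine Finset.sum_eq_zero fun c hc => ?_
  rw [W_false, mul_zero]
  intro x
  rw [hT c hc]
  omega

lemma count_odd (r k l : ℕ) (h : π.cycleType = Multiset.replicate k 2 + {l})
    (hr : 2 * k + l + 1 = 2 * r) :
    (pball π r ∩ pball 1 r).card =
      D k (fun j => 2 * j ≤ r ∧ r ≤ 2 * j + 1) + D k (fun j => l + 2 * j ≤ r ∧ r ≤ l + 2 * j + 1) +
      l * D k (fun j => 2 * j + 2 ≤ r ∧ r + 1 ≤ 2 * j + l) := by
  have hπ : π.support.card + 1 = 2 * r := by
    rw [← sum_cycleType, h, ← hr]; simp [mul_comm]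
  rw [G_card' π r hπ]
  have h' : π.cycleFactorsFinset.1.map (fun c => c.support.card) = l ::ₘ Multiset.replicate k 2 := by
    rw [add_comm, Multiset.singleton_add] at h
    exact h
  obtain ⟨c, hc, hcl, hT⟩ := extract _ _ _ h'
  obtain ⟨hk, h2⟩ := twos _ _ hT
  have hF : π.cycleFactorsFinset = insert c (π.cycleFactorsFinset.erase c) :=
    (Finset.insert_erase hc).symm
  have hnot : c ∉ π.cycleFactorsFinset.erase c := Finset.notMem_erase _ _
  have e1 : W π.cycleFactorsFinset (fun x => x ≤ r ∧ r ≤ x + 1) =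
      D k (fun j => 2 * j ≤ r ∧ r ≤ 2 * j + 1) +
      D k (fun j => l + 2 * j ≤ r ∧ r ≤ l + 2 * j + 1) := by
    rw [hF, W_insert c _ hnot, W_two _ h2, W_two _ h2, hk, hcl]
  have e2 : ∑ d ∈ π.cycleFactorsFinset, d.support.card *
       W (π.cycleFactorsFinset.erase d) (fun x => x + 2 ≤ r ∧ r + 1 ≤ x + d.support.card) =
       l * D k (fun j => 2 * j + 2 ≤ r ∧ r + 1 ≤ 2 * j + l) := by
    rw [← Finset.add_sum_erase _ _ hc, sum_twos r _ _ h2, W_two _ h2, hk, hcl, add_zero]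
  rw [e1, e2]

lemma count_even (r k l : ℕ) (h : π.cycleType = Multiset.replicate k 2 + {3, l})
    (hr : 2 * k + (3 + l) + 1 = 2 * r) :
    (pball π r ∩ pball 1 r).card =
      (D k (fun j => 2 * j ≤ r ∧ r ≤ 2 * j + 1) +
        D k (fun j => l + 2 * j ≤ r ∧ r ≤ l + 2 * j + 1) +
       (D k (fun j => 3 + 2 * j ≤ r ∧ r ≤ 3 + 2 * j + 1) +
        D k (fun j => 3 + (l + 2 * j) ≤ r ∧ r ≤ 3 + (l + 2 * j) + 1))) +
      (3 * (D k (fun j => 2 * j + 2 ≤ r ∧ r + 1 ≤ 2 * j + 3) +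
        D k (fun j => l + 2 * j + 2 ≤ r ∧ r + 1 ≤ l + 2 * j + 3)) +
       l * (D k (fun j => 2 * j + 2 ≤ r ∧ r + 1 ≤ 2 * j + l) +
        D k (fun j => 3 + 2 * j + 2 ≤ r ∧ r + 1 ≤ 3 + 2 * j + l))) := by
  have hπ : π.support.card + 1 = 2 * r := by
    rw [← sum_cycleType, h, ← hr]; simp [mul_comm]; omega
  rw [G_card' π r hπ]
  have h' : π.cycleFactorsFinset.1.map (fun c => c.support.card) =
      3 ::ₘ l ::ₘ Multiset.replicate k 2 := by
    rw [add_comm] at h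
    have h3 : π.cycleType = 3 ::ₘ l ::ₘ Multiset.replicate k 2 := by simpa using h
    exact h3
  obtain ⟨c, hc, hcl, hT1⟩ := extract _ _ _ h'
  obtain ⟨d, hd, hdl, hT⟩ := extract _ _ _ hT1
  obtain ⟨hk, h2⟩ := twos _ _ hT
  set T := (π.cycleFactorsFinset.erase c).erase d with hTdef
  have hF1 : π.cycleFactorsFinset.erase c = insert d T :=
    (Finset.insert_erase hd).symm
  have hF : π.cycleFactorsFinset = insert c (insert d T) := by
    rw [← hF1, Finset.insert_erase hc]
  have hcd : c ≠ d := by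
    rintro rfl
    simp at hd
  have hdT : d ∉ T := Finset.notMem_erase _ _
  have hcT : c ∉ T := by simp [hTdef]
  have hcT' : c ∉ insert d T := by simp [hcT, hcd]
  have hF2 : π.cycleFactorsFinset.erase d = insert c T := by
    rw [hF, Finset.erase_insert_of_ne hcd, Finset.erase_insert hdT]
  have e1 : W π.cycleFactorsFinset (fun x => x ≤ r ∧ r ≤ x + 1) =
      (D k (fun j => 2 * j ≤ r ∧ r ≤ 2 * j + 1) +
        D k (fun j => l + 2 * j ≤ r ∧ r ≤ l + 2 * j + 1) +
       (D k (fun j => 3 + 2 * j ≤ r ∧ r ≤ 3 + 2 * j + 1) +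
        D k (fun j => 3 + (l + 2 * j) ≤ r ∧ r ≤ 3 + (l + 2 * j) + 1))) := by
    rw [hF, W_insert c _ hcT', W_insert d _ hdT, W_insert d _ hdT]
    simp only [W_two _ h2, hk, hcl, hdl]
  have e2 : ∑ d ∈ π.cycleFactorsFinset, d.support.card *
       W (π.cycleFactorsFinset.erase d) (fun x => x + 2 ≤ r ∧ r + 1 ≤ x + d.support.card) =
       (3 * (D k (fun j => 2 * j + 2 ≤ r ∧ r + 1 ≤ 2 * j + 3) +
        D k (fun j => l + 2 * j + 2 ≤ r ∧ r + 1 ≤ l + 2 * j + 3)) +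
       l * (D k (fun j => 2 * j + 2 ≤ r ∧ r + 1 ≤ 2 * j + l) +
        D k (fun j => 3 + 2 * j + 2 ≤ r ∧ r + 1 ≤ 3 + 2 * j + l))) := by
    rw [← Finset.add_sum_erase _ _ hc, ← Finset.add_sum_erase _ _ hd, sum_twos r _ _ h2, hF1, hF2,
      W_insert d _ hdT, W_insert c _ hcT]
    simp only [W_two _ h2, hk, hcl, hdl, add_zero]
  rw [e1, e2]

lemma D_congr (k : ℕ) {P Q : ℕ → Prop} (h : ∀ j ≤ k, P j ↔ Q j) : D k P = D k Q := by
  classical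
  refine Finset.sum_congr rfl fun j hj => ?_
  simp only [h j (by simpa [Nat.lt_succ_iff] using hj)]

lemma D_reflect (k : ℕ) {P Q : ℕ → Prop} (h : ∀ i j, i + j = k → (P i ↔ Q j)) :
    D k P = D k Q := by
  classical
  unfold D
  rw [← Finset.sum_range_reflect]
  refine Finset.sum_congr rfl fun j hj => ?_
  have hj' : j ≤ k := by simpa [Nat.lt_succ_iff] using hj
  have e : k + 1 - 1 - j = k - j := by omega
  rw [e, Nat.choose_symm hj']
  simp only [h (k - j) j (by omega)]

lemma D_eq (k a : ℕ) {P : ℕ → Prop} (h : ∀ j ≤ k, P j ↔ j = a) : D k P = k.choose a := by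
  classical
  rw [D_congr k h]
  unfold D
  rw [Finset.sum_eq_single a]
  · simp
  · intro b _ hb
    simp [hb]
  · intro h
    rw [if_pos rfl, Nat.choose_eq_zero_of_lt]
    simpa [Nat.lt_succ_iff] using h

lemma D_eq' (k a : ℕ) {P : ℕ → Prop} (h : ∀ i j, i + j = k → (P i ↔ j = a)) :
    D k P = k.choose a := by
  rw [D_reflect k h]
  exact D_eq k a (fun _ _ => Iff.rfl)

lemma D_or (k : ℕ) {P Q R : ℕ → Prop} (h : ∀ j ≤ k, P j ↔ Q j ∨ R j)
    (h' : ∀ j ≤ k, ¬ (Q j ∧ R j)) : D k P = D k Q + D k R := by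
  classical
  unfold D
  rw [← Finset.sum_add_distrib]
  refine Finset.sum_congr rfl fun j hj => ?_
  have hj' : j ≤ k := by simpa [Nat.lt_succ_iff] using hj
  have h1 := h j hj'
  have h2 := h' j hj'
  by_cases hq : Q j <;> by_cases hr : R j <;> simp_all

lemma D_mono (k : ℕ) {P Q : ℕ → Prop} (h : ∀ j ≤ k, P j → Q j) : D k P ≤ D k Q := by
  classical
  unfold D
  refine Finset.sum_le_sum fun j hj => ?_
  have hj' : j ≤ k := by simpa [Nat.lt_succ_iff] using hj
  have h1 := h j hj'
  by_cases hp : P j <;> by_cases hq : Q j <;> simp_all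

lemma D_false (k : ℕ) {P : ℕ → Prop} (h : ∀ j ≤ k, ¬ P j) : D k P = 0 := by
  classical
  refine Finset.sum_eq_zero fun j hj => ?_
  rw [if_neg (h j (by simpa [Nat.lt_succ_iff] using hj))]

lemma D_succ (k : ℕ) (P : ℕ → Prop) : D (k + 1) P = D k P + D k (fun j => P (j + 1)) := by
  classical
  unfold D
  rw [Finset.sum_range_succ' _ (k + 1), Finset.sum_range_succ' (fun j => if P j then k.choose j else 0) k]
  have e : ∑ j ∈ Finset.range (k + 1), (if P (j + 1) then (k + 1).choose (j + 1) else 0) =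
      ∑ j ∈ Finset.range (k + 1), (if P (j + 1) then k.choose j else 0) +
      ∑ j ∈ Finset.range (k + 1), (if P (j + 1) then k.choose (j + 1) else 0) := by
    rw [← Finset.sum_add_distrib]
    refine Finset.sum_congr rfl fun j _ => ?_
    split_ifs
    · rw [Nat.choose_succ_succ]
    · rfl
  rw [e, Finset.sum_range_succ (fun j => if P (j + 1) then k.choose (j + 1) else 0) k,
    Nat.choose_succ_self]
  simp
  omega

/-- the middle sum -/
noncomputable def M (t s : ℕ) : ℕ := D (2 * t - s) (fun j => j < t ∧ t < j + s)

lemma M_rec (t s : ℕ) (ht : 1 ≤ t) (hs : 1 ≤ s) (hst : s + 1 ≤ 2 * t) :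
    2 * M t (s + 1) = M t s + 2 * (2 * t - s - 1).choose (t - 1) := by
  obtain ⟨k, hk⟩ : ∃ k, 2 * t - s = k + 1 := ⟨2 * t - s - 1, by omega⟩
  have hk1 : 2 * t - (s + 1) = k := by omega
  have hk2 : 2 * t - s - 1 = k := by omega
  have e1 : M t s = D k (fun j => j < t ∧ t < j + s) +
      D k (fun j => j + 1 < t ∧ t < j + 1 + s) := by rw [M, hk, D_succ]
  have e2 : M t (s + 1) = D k (fun j => j < t ∧ t < j + s) + k.choose (t - 1) := by
    rw [M, hk1, D_or k (Q := fun j => j < t ∧ t < j + s) (R := fun j => j + s = t)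
      (fun j hj => by omega) (fun j hj => by omega)]
    rw [D_eq' k (t - 1) (P := fun j => j + s = t) (fun i j hij => by omega)]
  have e3 : M t (s + 1) = D k (fun j => j + 1 < t ∧ t < j + 1 + s) + k.choose (t - 1) := by
    rw [M, hk1, D_or k (Q := fun j => j + 1 < t ∧ t < j + 1 + s) (R := fun j => j = t - 1)
      (fun j hj => by omega) (fun j hj => by omega)]
    rw [D_eq k (t - 1) (P := fun j => j = t - 1) (fun j hj => by omega)]
  rw [hk2]
  omega

lemma choose_desc (k a : ℕ) (h : k ≤ 2 * a + 1) : k.choose (a + 1) ≤ k.choose a := by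
  have h1 := Nat.choose_succ_right_eq k a
  have h2 : k.choose a * (k - a) ≤ k.choose a * (a + 1) := Nat.mul_le_mul_left _ (by omega)
  rw [← h1] at h2
  exact Nat.le_of_mul_le_mul_right h2 (by omega)

lemma M_ge (t s : ℕ) (ht : 2 ≤ t) (hs : 3 ≤ s) (hst : s + 1 ≤ 2 * t) :
    4 * (2 * t - s - 1).choose (t - 1) ≤ M t s := by
  obtain ⟨k, hk⟩ : ∃ k, 2 * t - s = k + 1 := ⟨2 * t - s - 1, by omega⟩
  have hk2 : 2 * t - s - 1 = k := by omega
  obtain ⟨u, rfl⟩ : ∃ u, t = u + 2 := ⟨t - 2, by omega⟩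
  have e0 : D (k+1) (fun j => j = u + 1 ∨ j + s = u + 3) ≤ M (u + 2) s := by
    rw [M, hk]
    exact D_mono _ (fun j hj => by omega)
  rw [D_or (k+1) (Q := fun j => j = u + 1) (R := fun j => j + s = u + 3) (fun j _ => Iff.rfl)
    (fun j hj => by omega), D_eq (k+1) (u+1) (fun j _ => Iff.rfl),
    D_eq' (k+1) (u+1) (fun i j hij => by omega), Nat.choose_succ_succ] at e0
  have := choose_desc k u (by omega)
  rw [hk2, show u + 2 - 1 = u + 1 by omega]
  simp only [Nat.succ_eq_add_one] at e0
  omega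

lemma M_two (t : ℕ) (ht : 2 ≤ t) : M t 2 = (2 * t - 2).choose (t - 1) :=
  D_eq _ _ (fun j hj => by omega)

lemma M_three (t : ℕ) (ht : 2 ≤ t) : M t 3 = (2 * t - 2).choose (t - 1) := by
  obtain ⟨u, rfl⟩ : ∃ u, t = u + 2 := ⟨t - 2, by omega⟩
  rw [M, D_or _ (Q := fun j => j = u) (R := fun j => j = u + 1) (fun j _ => by omega)
    (fun j hj => by omega), D_eq _ u (fun j _ => Iff.rfl), D_eq _ (u+1) (fun j _ => Iff.rfl),
    show 2 * (u + 2) - 2 = (2 * (u + 2) - 3) + 1 by omega, show u + 2 - 1 = u + 1 by omega,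
    Nat.choose_succ_succ]

/-- common form of the counts -/
noncomputable def V (t : ℕ) (q : ℤ) (s : ℕ) : ℤ :=
  2 * (2 * t - s).choose t + (2 * s + q) * M t s

lemma V_one (t : ℕ) (ht : 2 ≤ t) : V t 1 1 ≤ V t 1 2 := by
  have h1 : M t 1 = 0 := D_false _ (fun j _ => by omega)
  have h2 := M_two t ht
  have h3 : (2 * t - 1).choose t = (2 * t - 2).choose (t - 1) + (2 * t - 2).choose t := by
    rw [show 2 * t - 1 = (2 * t - 2) + 1 by omega]
    conv_lhs => rw [show t = (t - 1) + 1 by omega]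
    rw [Nat.choose_succ_succ]
    congr 2 <;> omega
  simp only [V]
  rw [h1, h2, h3]
  push_cast
  nlinarith [Nat.zero_le ((2 * t - 2).choose (t - 1))]

lemma V_diff (t s : ℕ) (q : ℤ) (ht : 1 ≤ t) (hs : 1 ≤ s) (hst : s + 1 ≤ 2 * t) :
    2 * (V t q s - V t q (s + 1)) = (2 * s - 2 + q) * M t s -
      2 * (2 * s + q) * (2 * t - s - 1).choose (t - 1) := by
  have h1 := M_rec t s ht hs hst
  have h3 : (2 * t - s).choose t =
      (2 * t - s - 1).choose (t - 1) + (2 * t - (s + 1)).choose t := by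
    rw [show 2 * t - s = (2 * t - s - 1) + 1 by omega]
    conv_lhs => rw [show t = (t - 1) + 1 by omega]
    rw [Nat.choose_succ_succ]
    congr 2 <;> omega
  have h1' : (2 : ℤ) * M t (s + 1) = M t s + 2 * (2 * t - s - 1).choose (t - 1) := by
    exact_mod_cast h1
  simp only [V]
  rw [h3]
  push_cast
  linear_combination (-(2 * (s:ℤ) + 2 + q)) * h1'

lemma V_two (t : ℕ) (q : ℤ) (ht : 2 ≤ t) : V t q 2 ≤ V t q 3 := by
  have h := V_diff t 2 q (by omega) (by omega) (by omega)
  have h1 := M_rec t 2 (by omega) (by omega) (by omega)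
  have h2 : M t 2 = M t 3 := by rw [M_two t ht, M_three t ht]
  have h3 : M t 2 = 2 * (2 * t - 2 - 1).choose (t - 1) := by
    norm_num at h1
    omega
  rw [h3] at h
  push_cast at h
  have h4 : (0 : ℤ) ≤ ((2 * t - 2 - 1).choose (t - 1) : ℕ) := Int.natCast_nonneg _
  nlinarith

lemma V_desc (t s : ℕ) (q : ℤ) (hq : -1 ≤ q) (ht : 2 ≤ t) (hs : 3 ≤ s) (hst : s + 1 ≤ 2 * t) :
    V t q (s + 1) ≤ V t q s := by
  have h := V_diff t s q (by omega) (by omega) hst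
  have h1 : (4 : ℤ) * (2 * t - s - 1).choose (t - 1) ≤ M t s := by
    exact_mod_cast M_ge t s ht hs hst
  have h4 : (0 : ℤ) ≤ ((2 * t - s - 1).choose (t - 1) : ℕ) := Int.natCast_nonneg _
  have hs' : (3 : ℤ) ≤ s := by exact_mod_cast hs
  have h5 : (2 * (s:ℤ) - 2 + q) * (4 * (2 * t - s - 1).choose (t - 1)) ≤
    (2 * s - 2 + q) * M t s := mul_le_mul_of_nonneg_left h1 (by linarith)
  nlinarith

lemma V_le (t s : ℕ) (q : ℤ) (hq : -1 ≤ q) (ht : 2 ≤ t) (hs : 2 ≤ s) (hst : s ≤ 2 * t) :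
    V t q s ≤ V t q 3 := by
  rcases Nat.lt_or_ge s 3 with h | h
  · have : s = 2 := by omega
    rw [this]; exact V_two t q ht
  · induction s, h using Nat.le_induction with
    | base => exact le_rfl
    | succ s h ih => exact (V_desc t s q hq ht h hst).trans (ih (by omega) (by omega))

lemma V_three (t : ℕ) (q : ℤ) (ht : 2 ≤ t) :
    V t q 3 = 2 * (2 * t - 3).choose t + (6 + q) * (2 * t - 2).choose (t - 1) := by
  rw [V, M_three t ht]
  norm_num

lemma odd_even_r (t s : ℕ) (hs : 2 ≤ s) (hst : s ≤ 2 * t)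
    (h : π.cycleType = Multiset.replicate (2 * t - s) 2 + {2 * s - 1}) :
    ((pball π (2 * t) ∩ pball 1 (2 * t)).card : ℤ) = V t (-1) s := by
  rw [count_odd π (2 * t) _ _ h (by omega), D_eq _ t (fun j _ => by omega),
    D_eq' _ t (fun i j _ => by omega), V, M,
    D_congr _ (Q := fun j => j < t ∧ t < j + s) (fun j _ => by omega)]
  push_cast [show 1 ≤ 2 * s by omega]
  ring

lemma odd_odd_r (t s : ℕ) (hst : s ≤ 2 * t)
    (h : π.cycleType = Multiset.replicate (2 * t - s) 2 + {2 * s + 1}) :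
    ((pball π (2 * t + 1) ∩ pball 1 (2 * t + 1)).card : ℤ) = V t 1 s := by
  rw [count_odd π (2 * t + 1) _ _ h (by omega), D_eq _ t (fun j _ => by omega),
    D_eq' _ t (fun i j _ => by omega), V, M,
    D_congr _ (Q := fun j => j < t ∧ t < j + s) (fun j _ => by omega)]
  push_cast
  ring

lemma even_odd_r (t s : ℕ) (hs : 2 ≤ s) (hst : s + 1 ≤ 2 * t)
    (h : π.cycleType = Multiset.replicate (2 * t - 1 - s) 2 + {3, 2 * s}) :
    ((pball π (2 * t + 1) ∩ pball 1 (2 * t + 1)).card : ℤ) ≤ V t 1 s := by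
  obtain ⟨k, hk⟩ : ∃ k, 2 * t - 1 - s = k := ⟨_, rfl⟩
  rw [hk] at h
  have hk2 : 2 * t - s = k + 1 := by omega
  obtain ⟨u, rfl⟩ : ∃ u, t = u + 1 := ⟨t - 1, by omega⟩
  have hM : M (u + 1) s = 2 * D k (fun j => j < u + 1 ∧ u + 1 < j + s) := by
    rw [M, hk2, D_succ, two_mul]
    congr 1
    exact D_reflect _ (fun i j _ => by omega)
  rw [count_even π _ _ _ h (by omega),
    D_eq _ (u+1) (P := fun j => 2 * j ≤ 2 * (u + 1) + 1 ∧ _) (fun j _ => by omega),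
    D_eq' _ u (P := fun j => 2 * s + 2 * j ≤ 2 * (u + 1) + 1 ∧ _) (fun i j _ => by omega),
    D_eq _ u (P := fun j => 3 + 2 * j ≤ 2 * (u + 1) + 1 ∧ _) (fun j _ => by omega),
    D_eq' _ (u+1) (P := fun j => 3 + (2 * s + 2 * j) ≤ 2 * (u + 1) + 1 ∧ _) (fun i j _ => by omega),
    D_false _ (P := fun j => 2 * j + 2 ≤ 2 * (u + 1) + 1 ∧ 2 * (u + 1) + 1 + 1 ≤ 2 * j + 3)
      (fun j _ => by omega),
    D_false _ (P := fun j => 2 * s + 2 * j + 2 ≤ 2 * (u + 1) + 1 ∧ _) (fun j _ => by omega),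
    D_congr _ (P := fun j => 2 * j + 2 ≤ 2 * (u + 1) + 1 ∧ _)
      (Q := fun j => j < u + 1 ∧ u + 1 < j + s) (fun j _ => by omega),
    D_reflect _ (P := fun j => 3 + 2 * j + 2 ≤ 2 * (u + 1) + 1 ∧ _)
      (Q := fun j => j < u + 1 ∧ u + 1 < j + s) (fun i j _ => by omega),
    V, hM, hk2, Nat.choose_succ_succ]
  push_cast
  nlinarith [Nat.zero_le (D k (fun j => j < u + 1 ∧ u + 1 < j + s))]

lemma even_even_r (t s : ℕ) (hs : 2 ≤ s) (hst : s + 2 ≤ 2 * t)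
    (h : π.cycleType = Multiset.replicate (2 * t - s - 2) 2 + {3, 2 * s}) :
    ((pball π (2 * t) ∩ pball 1 (2 * t)).card : ℤ) ≤ V t (-1) s := by
  obtain ⟨k, hk⟩ : ∃ k, 2 * t - s - 2 = k := ⟨_, rfl⟩
  rw [hk] at h
  have hk2 : 2 * t - s = k + 1 + 1 := by omega
  obtain ⟨u, rfl⟩ : ∃ u, t = u + 2 := ⟨t - 2, by omega⟩
  set m := D k (fun j => j < u + 2 ∧ u + 2 < j + s) with hm
  set m' := D k (fun j => j + 1 < u + 2 ∧ u + 2 < j + 1 + s) with hm'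
  have hM : M (u + 2) s = 2 * m + 2 * m' := by
    have : D k (fun j => j + 1 + 1 < u + 2 ∧ u + 2 < j + 1 + 1 + s) = m :=
      D_reflect _ (fun i j _ => by omega)
    rw [M, hk2, D_succ, D_succ, D_succ, this]
    omega
  have h1 : m' + k.choose (u + 1) = m + k.choose u := by
    rw [← D_eq k (u+1) (P := fun j => j = u + 1) (fun j _ => Iff.rfl),
      ← D_eq' k u (P := fun j => j + s = u + 2) (fun i j _ => by omega), hm, hm',
      ← D_or k (P := fun j => j < u + 2 ∧ u + 2 < j + 1 + s) (fun j _ => by omega)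
        (fun j _ => by omega),
      ← D_or k (P := fun j => j < u + 2 ∧ u + 2 < j + 1 + s) (fun j _ => by omega)
        (fun j _ => by omega)]
  have h2 : k.choose (u + 1) ≤ m := by
    rw [← D_eq k (u+1) (P := fun j => j = u + 1) (fun j _ => Iff.rfl)]
    exact D_mono _ (fun j _ => by omega)
  have h3 := choose_desc k u (by omega)
  rw [count_even π _ _ _ h (by omega),
    D_eq _ (u+2) (P := fun j => 2 * j ≤ 2 * (u + 2) ∧ _) (fun j _ => by omega),
    D_eq' _ u (P := fun j => 2 * s + 2 * j ≤ 2 * (u + 2) ∧ _) (fun i j _ => by omega),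
    D_eq _ u (P := fun j => 3 + 2 * j ≤ 2 * (u + 2) ∧ _) (fun j _ => by omega),
    D_eq' _ (u+2) (P := fun j => 3 + (2 * s + 2 * j) ≤ 2 * (u + 2) ∧ _) (fun i j _ => by omega),
    D_eq _ (u+1) (P := fun j => 2 * j + 2 ≤ 2 * (u + 2) ∧ 2 * (u + 2) + 1 ≤ 2 * j + 3)
      (fun j _ => by omega),
    D_eq' _ (u+1) (P := fun j => 2 * s + 2 * j + 2 ≤ 2 * (u + 2) ∧ _) (fun i j _ => by omega),
    D_congr _ (P := fun j => 2 * j + 2 ≤ 2 * (u + 2) ∧ _)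
      (Q := fun j => j < u + 2 ∧ u + 2 < j + s) (fun j _ => by omega),
    D_reflect _ (P := fun j => 3 + 2 * j + 2 ≤ 2 * (u + 2) ∧ _)
      (Q := fun j => j < u + 2 ∧ u + 2 < j + s) (fun i j _ => by omega),
    V, hM, hk2, Nat.choose_succ_succ, Nat.choose_succ_succ, Nat.choose_succ_succ, ← hm]
  simp only [Nat.succ_eq_add_one]
  have h1' : (m' : ℤ) + k.choose (u + 1) = m + k.choose u := by exact_mod_cast h1
  have h2' : (k.choose (u + 1) : ℤ) ≤ m := by exact_mod_cast h2
  have h3' : (k.choose (u + 1) : ℤ) ≤ k.choose u := by exact_mod_cast h3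
  have hs' : (2 : ℤ) ≤ s := by exact_mod_cast hs
  have hmm : (m : ℤ) ≤ m' := by linarith
  have hm0 : (0 : ℤ) ≤ m := Int.natCast_nonneg _
  push_cast
  have h6 : (2 * (s:ℤ) - 1) * m ≤ (2 * s - 1) * m' := mul_le_mul_of_nonneg_left hmm (by linarith)
  have h7 : (2 : ℤ) * m ≤ s * m := mul_le_mul_of_nonneg_right hs' hm0
  nlinarith

end Stmt16

/-- Let `t ≥ 2`, `r = 2t` or `r = 2t + 1`, `n ≥ 2r - 1`. For each
`3 ≤ ℓ ≤ 2r - 1`, let `π ℓ` be any permutation of `Fin n` whose cycle type is: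
`r - s` parts equal to `2` together with one part `ℓ` if `ℓ = 2s - 1` is odd, and
`r - s - 2` parts equal to `2`, one part `3` and one part `ℓ` if `ℓ = 2s` is even
(in both cases `|support (π ℓ)| = 2r - 1`; for the even case this forces `s ≤ r - 2`,
so the single even value `ℓ = 2r - 2`, for which no permutation of weight `2r - 1` of
this shape exists, is excluded from the range). Then the maximum over such `ℓ` of
`|B_r(π ℓ) ∩ B_r(1)|` equals `2·C(2t-3, t) + ℓ*·C(2t-2, t-1)` where `ℓ* = 5` if
`r = 2t` and `ℓ* = 7` if `r = 2t + 1`; moreover the maximum is attained at `ℓ = ℓ*`. -/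
theorem stmt16 (n t r : ℕ) (ht : 2 ≤ t) (hr : r = 2 * t ∨ r = 2 * t + 1)
    (hn : 2 * r - 1 ≤ n)
    (π : ℕ → Equiv.Perm (Fin n))
    (hodd : ∀ s, 2 ≤ s → s ≤ r →
      (π (2 * s - 1)).cycleType = Multiset.replicate (r - s) 2 + {2 * s - 1})
    (heven : ∀ s, 2 ≤ s → s + 2 ≤ r →
      (π (2 * s)).cycleType = Multiset.replicate (r - s - 2) 2 + {3, 2 * s}) :
    IsGreatest
      (↑(((Finset.Icc 3 (2 * r - 1)).erase (2 * r - 2)).image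
          fun ℓ => (pball (π ℓ) r ∩ pball 1 r).card) : Set ℕ)
      (2 * Nat.choose (2 * t - 3) t +
        (if r = 2 * t then 5 else 7) * Nat.choose (2 * t - 2) (t - 1)) ∧
    (pball (π (if r = 2 * t then 5 else 7)) r ∩ pball 1 r).card =
      2 * Nat.choose (2 * t - 3) t +
        (if r = 2 * t then 5 else 7) * Nat.choose (2 * t - 2) (t - 1) := by
  have hmem : ∀ l, l ∈ (Finset.Icc 3 (2 * r - 1)).erase (2 * r - 2) →
      (∃ s, 2 ≤ s ∧ s ≤ r ∧ l = 2 * s - 1) ∨ (∃ s, 2 ≤ s ∧ s + 2 ≤ r ∧ l = 2 * s) := by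
    intro l hl
    rw [Finset.mem_erase, Finset.mem_Icc] at hl
    rcases Nat.even_or_odd' l with ⟨s, hs | hs⟩
    · exact Or.inr ⟨s, by omega, by omega, hs⟩
    · exact Or.inl ⟨s + 1, by omega, by omega, by omega⟩
  have main : (pball (π (if r = 2 * t then 5 else 7)) r ∩ pball 1 r).card =
      2 * Nat.choose (2 * t - 3) t +
        (if r = 2 * t then 5 else 7) * Nat.choose (2 * t - 2) (t - 1) := by
    rcases hr with rfl | rfl
    · rw [if_pos rfl]
      have h := hodd 3 (by omega) (by omega)
      have h1 := Stmt16.odd_even_r (π 5) t 3 (by omega) (by omega) h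
      rw [Stmt16.V_three t _ ht] at h1
      norm_num at h1
      exact_mod_cast h1
    · rw [if_neg (by omega)]
      have h := hodd 4 (by omega) (by omega)
      have h1 := Stmt16.odd_odd_r (π 7) t 3 (by omega)
        (by rw [show 2 * t - 3 = 2 * t + 1 - 4 by omega]; exact h)
      rw [Stmt16.V_three t _ ht] at h1
      norm_num at h1
      exact_mod_cast h1
  refine ⟨⟨?_, ?_⟩, main⟩
  · rw [Finset.mem_coe, Finset.mem_image]
    refine ⟨_, ?_, main⟩
    rw [Finset.mem_erase, Finset.mem_Icc]
    split_ifs <;> omega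
  · intro x hx
    rw [Finset.mem_coe, Finset.mem_image] at hx
    obtain ⟨l, hl, rfl⟩ := hx
    have hl := hmem l hl
    show (pball (π l) r ∩ pball 1 r).card ≤ _
    rcases hr with rfl | rfl
    · rw [if_pos rfl]
      have hV := Stmt16.V_three t (-1) ht
      have key : ((pball (π l) (2 * t) ∩ pball 1 (2 * t)).card : ℤ) ≤ Stmt16.V t (-1) 3 := by
        rcases hl with ⟨s, h2, hs, rfl⟩ | ⟨s, h2, hs, rfl⟩
        · rw [Stmt16.odd_even_r _ t s h2 hs (hodd s h2 hs)]
          exact Stmt16.V_le t s _ (by norm_num) ht h2 hs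
        · exact (Stmt16.even_even_r _ t s h2 hs (heven s h2 hs)).trans
            (Stmt16.V_le t s _ (by norm_num) ht h2 (by omega))
      rw [hV] at key
      norm_num at key
      exact_mod_cast key
    · rw [if_neg (by omega)]
      have hV := Stmt16.V_three t 1 ht
      have key : ((pball (π l) (2 * t + 1) ∩ pball 1 (2 * t + 1)).card : ℤ) ≤
          Stmt16.V t 1 3 := by
        rcases hl with ⟨s, h2, hs, rfl⟩ | ⟨s, h2, hs, rfl⟩
        · obtain ⟨u, rfl⟩ : ∃ u, s = u + 1 := ⟨s - 1, by omega⟩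
          have h := hodd (u + 1) h2 hs
          rw [show 2 * t + 1 - (u + 1) = 2 * t - u by omega,
            show 2 * (u + 1) - 1 = 2 * u + 1 by omega] at h
          rw [show 2 * (u + 1) - 1 = 2 * u + 1 by omega]
          rw [Stmt16.odd_odd_r _ t u (by omega) h]
          rcases Nat.lt_or_ge u 2 with hu | hu
          · have : u = 1 := by omega
            rw [this]
            exact (Stmt16.V_one t ht).trans (Stmt16.V_two t 1 ht)
          · exact Stmt16.V_le t u _ (by norm_num) ht hu (by omega)
        · have h := heven s h2 hs
          rw [show 2 * t + 1 - s - 2 = 2 * t - 1 - s by omega] at h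
          exact (Stmt16.even_odd_r _ t s h2 (by omega) h).trans
            (Stmt16.V_le t s _ (by norm_num) ht h2 (by omega))
      rw [hV] at key
      norm_num at key
      exact_mod_cast key
end

section
/- For all n ≥ 10, N(n, 9, 5) = 18; that is: (1) for all permutations π, τ of Fin n with d(π, τ) ≥ 9, |B_5(π) ∩ B_5(τ)| ≤ 18; and (2) there exist permutations π, τ with d(π, τ) ≥ 9 and |B_5(π) ∩ B_5(τ)| = 18 (e.g., τ = 1 and π a product of three disjoint 3-cycles, of cycle type [3^3]). -/
/-- `N(n, d, r)`: the maximum of `|B_r(π) ∩ B_r(τ)|` over pairs of permutations of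
`Fin n` at Hamming distance at least `d`. -/
def Nmax (n d r : ℕ) : ℕ :=
  (Finset.univ.filter fun p : Equiv.Perm (Fin n) × Equiv.Perm (Fin n) =>
      d ≤ hdist p.1 p.2).sup fun p => (pball p.1 r ∩ pball p.2 r).card

open Equiv Equiv.Perm

theorem hdist_eq_support {n : ℕ} (a b : Perm (Fin n)) : hdist a b = (a⁻¹ * b).support.card := by
  unfold hdist
  congr 1
  ext i
  simp only [Finset.mem_filter, Finset.mem_univ, true_and, mem_support, Perm.mul_apply, ne_eq,
    Perm.inv_eq_iff_eq]
  exact not_congr eq_comm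

theorem hdist_mul_left {n : ℕ} (g a b : Perm (Fin n)) : hdist (g * a) (g * b) = hdist a b := by
  unfold hdist
  simp

theorem hdist_mul_right {n : ℕ} (g a b : Perm (Fin n)) : hdist (a * g) (b * g) = hdist a b := by
  unfold hdist
  refine Finset.card_bij (fun i _ => g i) ?_ ?_ ?_
  · intro i hi
    rw [Finset.mem_filter] at hi ⊢
    exact ⟨Finset.mem_univ _, hi.2⟩
  · intro i _ j _ h; exact g.injective h
  · intro j hj
    rw [Finset.mem_filter] at hj
    refine ⟨g⁻¹ j, ?_, by simp⟩
    rw [Finset.mem_filter]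
    exact ⟨Finset.mem_univ _, by simpa using hj.2⟩

theorem hdist_symm {n : ℕ} (a b : Perm (Fin n)) : hdist a b = hdist b a := by
  unfold hdist
  simp only [ne_comm]

theorem hdist_tri {n : ℕ} (a b c : Perm (Fin n)) : hdist a c ≤ hdist a b + hdist b c := by
  unfold hdist
  refine le_trans (Finset.card_le_card ?_) (Finset.card_union_le _ _)
  intro i
  simp only [Finset.mem_filter, Finset.mem_univ, true_and, Finset.mem_union]
  intro h
  by_contra! h2
  exact h (h2.1.trans h2.2)

/-- Size of the intersection of two balls of radius 5. -/
def interCard {n : ℕ} (a b : Perm (Fin n)) : ℕ := (pball a 5 ∩ pball b 5).card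

theorem mem_inter {n : ℕ} (a b s : Perm (Fin n)) :
    s ∈ pball a 5 ∩ pball b 5 ↔ hdist a s ≤ 5 ∧ hdist b s ≤ 5 := by
  simp [pball]

theorem interCard_mul_left {n : ℕ} (g a b : Perm (Fin n)) :
    interCard (g * a) (g * b) = interCard a b := by
  symm
  refine Finset.card_bij (fun s _ => g * s) ?_ ?_ ?_
  · intro s; simp only [mem_inter, hdist_mul_left]; exact id
  · intro s _ t _ h; exact mul_left_cancel h
  · intro s hs
    refine ⟨g⁻¹ * s, ?_, by simp⟩
    rw [mem_inter] at *
    rw [← hdist_mul_left g a, ← hdist_mul_left g b]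
    simpa using hs

theorem interCard_mul_right {n : ℕ} (g a b : Perm (Fin n)) :
    interCard (a * g) (b * g) = interCard a b := by
  symm
  refine Finset.card_bij (fun s _ => s * g) ?_ ?_ ?_
  · intro s; simp only [mem_inter, hdist_mul_right]; exact id
  · intro s _ t _ h; exact mul_right_cancel h
  · intro s hs
    refine ⟨s * g⁻¹, ?_, by simp⟩
    rw [mem_inter] at *
    rw [← hdist_mul_right g a, ← hdist_mul_right g b]
    simpa using hs

theorem interCard_conj {n : ℕ} {a b : Perm (Fin n)} (h : IsConj a b) :
    interCard a 1 = interCard b 1 := by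
  obtain ⟨g, rfl⟩ := isConj_iff.1 h
  have h1 := interCard_mul_right g⁻¹ (g * a) (g * 1)
  rw [interCard_mul_left] at h1
  rw [← h1]; simp

/-- Extension of a permutation of `Fin m` to `Fin n`. -/
def extP {m n : ℕ} (h : m ≤ n) (p : Perm (Fin m)) : Perm (Fin n) :=
  p.extendDomain (Fin.castLEOrderIso h).toEquiv

theorem extP_castLE {m n : ℕ} (h : m ≤ n) (p : Perm (Fin m)) (i : Fin m) :
    extP h p (Fin.castLE h i) = Fin.castLE h (p i) :=
  extendDomain_apply_image p (Fin.castLEOrderIso h).toEquiv i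

theorem extP_ge {m n : ℕ} (h : m ≤ n) (p : Perm (Fin m)) (i : Fin n) (hi : ¬ i.val < m) :
    extP h p i = i :=
  extendDomain_apply_not_subtype p (Fin.castLEOrderIso h).toEquiv hi

theorem hdist_extP {m n : ℕ} (h : m ≤ n) (p q : Perm (Fin m)) :
    hdist (extP h p) (extP h q) = hdist p q := by
  rw [hdist_eq_support, hdist_eq_support]
  unfold extP
  rw [extendDomain_inv, extendDomain_mul, card_support_extend_domain]

theorem extP_one {m n : ℕ} (h : m ≤ n) : extP h (1 : Perm (Fin m)) = 1 := extendDomain_one _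

theorem extP_inj {m n : ℕ} (h : m ≤ n) : Function.Injective (extP h) :=
  extendDomainHom_injective (Fin.castLEOrderIso h).toEquiv

/-- If a permutation fixes everything `≥ m`, it is an extension. -/
theorem exists_extP {m n : ℕ} (h : m ≤ n) (s : Perm (Fin n))
    (hs : ∀ i : Fin n, ¬ i.val < m → s i = i) : ∃ q : Perm (Fin m), extP h q = s := by
  have hp : ∀ x : Fin n, (s x).val < m ↔ x.val < m := by
    intro x
    constructor
    · intro hx
      by_contra hc
      rw [hs x hc] at hx
      exact hc hx
    · intro hx
      by_contra hc
      have := s.injective (hs _ hc)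
      rw [this] at hc
      exact hc hx
  let f := (Fin.castLEOrderIso h).toEquiv
  refine ⟨f.symm.permCongr (s.subtypePerm hp), ?_⟩
  ext1 i
  by_cases hi : i.val < m
  · unfold extP
    rw [extendDomain_apply_subtype (p := fun i : Fin n => i.val < m) _ _ hi]
    simp [Equiv.permCongr_apply, f]
  · rw [extP_ge h _ _ hi, hs i hi]

theorem interCard_extP {m n : ℕ} (h : m ≤ n) (hm : 9 ≤ m) (p : Perm (Fin m))
    (hp : ∀ i, p i ≠ i) : interCard (extP h p) 1 = interCard p 1 := by
  symm
  refine Finset.card_bij (fun s _ => extP h s) ?_ ?_ ?_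
  · intro s
    rw [mem_inter, mem_inter, hdist_extP, ← hdist_extP h 1, extP_one]
    exact id
  · intro s _ t _ e
    exact extP_inj h e
  · intro s hs
    rw [mem_inter] at hs
    have key : ∃ q : Perm (Fin m), extP h q = s := by
      apply exists_extP
      intro i hi
      by_contra hne
      obtain ⟨h1, h2⟩ := hs
      unfold hdist at h1 h2
      set A := Finset.univ.filter fun j => extP h p j ≠ s j
      set B := Finset.univ.filter fun j => (1 : Perm (Fin n)) j ≠ s j
      have hiA : i ∈ A := by
        simp only [A, Finset.mem_filter, Finset.mem_univ, true_and]
        rw [extP_ge h _ _ hi]; exact fun e => hne e.symm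
      have hiB : i ∈ B := by
        simp only [B, Finset.mem_filter, Finset.mem_univ, true_and]
        exact fun e => hne e.symm
      have hU : insert i ((Finset.univ : Finset (Fin m)).map (Fin.castLEEmb h)) ⊆ A ∪ B := by
        intro j hj
        rw [Finset.mem_insert] at hj
        rcases hj with rfl | hj
        · exact Finset.mem_union_left _ hiA
        · rw [Finset.mem_map] at hj
          obtain ⟨k, _, rfl⟩ := hj
          simp only [A, B, Finset.mem_filter, Finset.mem_univ, true_and, Finset.mem_union]
          by_contra! hc
          have h3 := hc.1.trans hc.2.symm
          have h4 := extP_castLE h p k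
          change extP h p (Fin.castLE h k) = Fin.castLE h k at h3
          rw [h4] at h3
          exact hp k (Fin.castLE_injective h h3)
      have hc1 := Finset.card_le_card hU
      rw [Finset.card_insert_of_notMem, Finset.card_map, Finset.card_univ, Fintype.card_fin] at hc1
      · have hc2 := Finset.card_union_add_card_inter A B
        have hc3 : 1 ≤ (A ∩ B).card := Finset.card_pos.2 ⟨i, Finset.mem_inter.2 ⟨hiA, hiB⟩⟩
        omega
      · rw [Finset.mem_map]
        rintro ⟨k, _, rfl⟩
        exact hi k.2
    obtain ⟨q, rfl⟩ := key
    refine ⟨q, ?_, rfl⟩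
    rw [mem_inter]
    rw [hdist_extP, ← extP_one h, hdist_extP] at hs
    exact hs

/-! ### The agreement sets -/

/-- Where `s` agrees with `p`. -/
def agr {m : ℕ} (p s : Perm (Fin m)) : Finset (Fin m) := Finset.univ.filter fun i => p i = s i

theorem mem_agr {m : ℕ} {p s : Perm (Fin m)} {i : Fin m} : i ∈ agr p s ↔ p i = s i := by
  simp [agr]

theorem card_agr {m : ℕ} (p s : Perm (Fin m)) : (agr p s).card + hdist p s = m := by
  have := Finset.card_filter_add_card_filter_not (s := (Finset.univ : Finset (Fin m)))
    (fun i => p i = s i)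
  simpa [agr, hdist] using this

theorem agr_disj {m : ℕ} {p : Perm (Fin m)} (hp : ∀ i, p i ≠ i) (s : Perm (Fin m)) :
    Disjoint (agr p s ∪ (agr p s).image p) (agr 1 s) := by
  rw [Finset.disjoint_left]
  intro i hi hT
  rw [mem_agr] at hT
  rw [Finset.mem_union, Finset.mem_image] at hi
  rcases hi with hi | ⟨j, hj, rfl⟩
  · rw [mem_agr] at hi
    exact hp i (hi.trans hT.symm)
  · rw [mem_agr] at hj
    have h1 : s (p j) = s j := by
      rw [← hT, ← hj]; rfl
    exact hp j (s.injective h1)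

theorem eq_of_agr {m : ℕ} {p s t : Perm (Fin m)} (hp : ∀ i, p i ≠ i)
    (hS : agr p s = agr p t) (hT : agr 1 s = agr 1 t)
    (hc : m ≤ (agr p s).card + (agr 1 s).card + 1) : s = t := by
  have h1 : hdist s t ≤ 1 := by
    have hd : Disjoint (agr p s) (agr 1 s) :=
      Finset.disjoint_of_subset_left Finset.subset_union_left (agr_disj hp s)
    have hsub : agr p s ∪ agr 1 s ⊆ agr s t := by
      intro i hi
      rw [Finset.mem_union] at hi
      rcases hi with hi | hi
      · have hi2 := hS ▸ hi
        rw [mem_agr] at *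
        rw [← hi, hi2]
      · have hi2 := hT ▸ hi
        rw [mem_agr] at *
        rw [← hi, hi2]
    have := Finset.card_le_card hsub
    rw [Finset.card_union_of_disjoint hd] at this
    have := card_agr s t
    omega
  rw [hdist_eq_support, card_support_le_one] at h1
  exact (inv_mul_eq_one.1 h1)

/-- Condition on the agreement set, nine points. -/
def Q9 (p : Fin 9 → Fin 9) (S : Finset (Fin 9)) : Prop :=
  (S.card = 5 ∧ S ∪ S.image p = S) ∨
  (S.card = 4 ∧ (S ∪ S.image p).card ≤ 5 ∧
    ((S ∪ S.image p).card = 4 ∨ (S ∪ S.image p).image p ≠ S ∪ S.image p))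

instance (p : Fin 9 → Fin 9) : DecidablePred (Q9 p) := fun S => by unfold Q9; infer_instance

/-- Condition on the agreement set, ten points. -/
def Q10 (p : Fin 10 → Fin 10) (S : Finset (Fin 10)) : Prop :=
  S.card = 5 ∧ S ∪ S.image p = S

instance (p : Fin 10 → Fin 10) : DecidablePred (Q10 p) := fun S => by unfold Q10; infer_instance

theorem compl_of_card {m : ℕ} {A B : Finset (Fin m)} (h : Disjoint A B)
    (hc : m ≤ A.card + B.card) : B = Aᶜ := by
  apply Finset.eq_of_subset_of_card_le
  · intro i hi
    rw [Finset.mem_compl]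
    exact fun hA => Finset.disjoint_left.1 h hA hi
  · rw [Finset.card_compl, Fintype.card_fin]; omega

theorem bound10 (p : Perm (Fin 10)) (hp : ∀ i, p i ≠ i) :
    interCard p 1 ≤ (Finset.univ.filter (Q10 p)).card := by
  have main : ∀ s ∈ pball p 5 ∩ pball 1 5,
      Q10 p (agr p s) ∧ agr 1 s = (agr p s ∪ (agr p s).image p)ᶜ ∧
      10 ≤ (agr p s).card + (agr 1 s).card + 1 := by
    intro s hs
    rw [mem_inter] at hs
    have hS := card_agr p s
    have hT := card_agr 1 s
    have hd := agr_disj hp s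
    have hcu := Finset.card_union_of_disjoint hd
    have hle := Finset.card_le_univ ((agr p s ∪ (agr p s).image p) ∪ agr 1 s)
    rw [Fintype.card_fin] at hle
    have hsub : (agr p s) ⊆ (agr p s ∪ (agr p s).image p) := Finset.subset_union_left
    have hsc := Finset.card_le_card hsub
    refine ⟨⟨by omega, ?_⟩, compl_of_card hd (by omega), by omega⟩
    exact (Finset.eq_of_subset_of_card_le hsub (by omega)).symm
  refine Finset.card_le_card_of_injOn (fun s => agr p s) ?_ ?_
  · intro s hs
    have := (main s hs).1
    simpa using this
  · intro s hs t ht e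
    have h1 := main s hs
    have h2 := main t ht
    simp only at e
    refine eq_of_agr hp e ?_ h1.2.2
    rw [h1.2.1, h2.2.1, e]

theorem bound9 (p : Perm (Fin 9)) (hp : ∀ i, p i ≠ i) :
    interCard p 1 ≤ (Finset.univ.filter (Q9 p)).card := by
  have main : ∀ s ∈ pball p 5 ∩ pball 1 5,
      Q9 p (agr p s) ∧ agr 1 s = (agr p s ∪ (agr p s).image p)ᶜ ∧
      9 ≤ (agr p s).card + (agr 1 s).card + 1 := by
    intro s hs
    rw [mem_inter] at hs
    have hS := card_agr p s
    have hT := card_agr 1 s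
    have hd := agr_disj hp s
    have hcu := Finset.card_union_of_disjoint hd
    have hle := Finset.card_le_univ ((agr p s ∪ (agr p s).image p) ∪ agr 1 s)
    rw [Fintype.card_fin] at hle
    have hsub : (agr p s) ⊆ (agr p s ∪ (agr p s).image p) := Finset.subset_union_left
    have hsc := Finset.card_le_card hsub
    have himg : (agr p s).image p = (agr p s).image s := by
      apply Finset.image_congr
      intro i hi
      exact mem_agr.1 hi
    set U := agr p s ∪ (agr p s).image p with hU
    -- the fixed points are exactly the complement of `U`
    have hTc : agr 1 s = Uᶜ := by
      by_cases h9 : 9 ≤ U.card + (agr 1 s).card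
      · exact compl_of_card hd h9
      · exfalso
        have hUS : agr p s = U := Finset.eq_of_subset_of_card_le hsub (by omega)
        have hcard : (U ∪ agr 1 s).card = 8 := by omega
        have hcc : ((U ∪ agr 1 s)ᶜ).card = 1 := by
          rw [Finset.card_compl, hcard]; rfl
        obtain ⟨x, hx⟩ := Finset.card_eq_one.1 hcc
        have hx2 : x ∉ U ∪ agr 1 s := by
          rw [← Finset.mem_compl, hx]; simp
        have hall : ∀ y, y ∉ U → y ∉ agr 1 s → y = x := by
          intro y h1 h2
          have : y ∈ (U ∪ agr 1 s)ᶜ := by simp [h1, h2]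
          rw [hx] at this; simpa using this
        rw [Finset.mem_union, not_or] at hx2
        -- image of U under s is U
        have hsU : U.image s = U := by
          have h1 : U.image s ⊆ U := by
            conv_lhs => rw [← hUS, ← himg]
            exact Finset.subset_union_right
          exact Finset.eq_of_subset_of_card_le h1 (by
            rw [Finset.card_image_of_injective _ s.injective])
        have hsx : s x ≠ x := fun e => hx2.2 (mem_agr.2 (by simp [e]))
        by_cases hsxU : s x ∈ U
        · rw [← hsU, Finset.mem_image] at hsxU
          obtain ⟨y, hy, e⟩ := hsxU
          rw [s.injective e] at hy
          exact hx2.1 hy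
        · by_cases hsxT : s x ∈ agr 1 s
          · rw [mem_agr] at hsxT
            exact hsx (s.injective hsxT.symm)
          · exact hsx (hall _ hsxU hsxT)
    refine ⟨?_, hTc, by omega⟩
    unfold Q9
    rw [← hU]
    by_cases h5 : (agr p s).card = 5
    · left
      exact ⟨h5, (Finset.eq_of_subset_of_card_le hsub (by omega)).symm⟩
    · right
      refine ⟨by omega, by omega, ?_⟩
      by_contra! hcon
      obtain ⟨hc4, hinv⟩ := hcon
      -- s maps U to U
      have hsU : ∀ y ∈ U, s y ∈ U := by
        intro y hy
        by_contra hc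
        have h1 : s y ∈ agr 1 s := by rw [hTc]; simpa using hc
        rw [mem_agr] at h1
        have h2 : y = s y := s.injective h1
        rw [← h2] at hc
        exact hc hy
      have hss : agr p s ⊂ U := by
        refine Finset.ssubset_iff_subset_ne.2 ⟨hsub, ?_⟩
        intro e
        rw [← e] at hc4 
        omega
      obtain ⟨x, hxU, hxS⟩ := Finset.exists_of_ssubset hss
      have hins : insert x (agr p s) = U := by
        apply Finset.eq_of_subset_of_card_le
        · exact Finset.insert_subset hxU hsub
        · rw [Finset.card_insert_of_notMem hxS]; omega
      have hsx := hsU x hxU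
      rw [← hinv, Finset.mem_image] at hsx
      obtain ⟨y, hy, e⟩ := hsx
      rw [← hins, Finset.mem_insert] at hy
      rcases hy with rfl | hy
      · exact hxS (mem_agr.2 e)
      · rw [mem_agr] at hy
        have : y = x := s.injective (hy.symm.trans e)
        subst this
        exact hxS (mem_agr.2 hy)
  refine Finset.card_le_card_of_injOn (fun s => agr p s) ?_ ?_
  · intro s hs
    have := (main s hs).1
    simpa using this
  · intro s hs t ht e
    have h1 := main s hs
    have h2 := main t ht
    simp only at e
    refine eq_of_agr hp e ?_ h1.2.2
    rw [h1.2.1, h2.2.1, e]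

/-! ### Representatives of the cycle types -/

/-- The product of the cycles in a list. -/
def cyc {m : ℕ} (l : List (List (Fin m))) : Perm (Fin m) := (l.map List.formPerm).prod

/-- A cycle type has a good representative on nine points. -/
def Good9 (c : Multiset ℕ) (l : List (List (Fin 9))) : Prop :=
  (cyc l).cycleType = c ∧ (∀ i, cyc l i ≠ i) ∧ (Finset.univ.filter (Q9 (cyc l))).card ≤ 18

instance (c : Multiset ℕ) (l : List (List (Fin 9))) : Decidable (Good9 c l) := by
  unfold Good9; infer_instance

/-- A cycle type has a good representative on ten points. -/
def Good10 (c : Multiset ℕ) (l : List (List (Fin 10))) : Prop :=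
  (cyc l).cycleType = c ∧ (∀ i, cyc l i ≠ i) ∧ (Finset.univ.filter (Q10 (cyc l))).card ≤ 18

instance (c : Multiset ℕ) (l : List (List (Fin 10))) : Decidable (Good10 c l) := by
  unfold Good10; infer_instance

set_option maxRecDepth 100000

theorem g9 : Good9 {9} [[0,1,2,3,4,5,6,7,8]] := by decide +kernel
theorem g27 : Good9 {2,7} [[0,1],[2,3,4,5,6,7,8]] := by decide +kernel
theorem g36 : Good9 {3,6} [[0,1,2],[3,4,5,6,7,8]] := by decide +kernel
theorem g45 : Good9 {4,5} [[0,1,2,3],[4,5,6,7,8]] := by decide +kernel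
theorem g225 : Good9 {2,2,5} [[0,1],[2,3],[4,5,6,7,8]] := by decide +kernel
theorem g234 : Good9 {2,3,4} [[0,1],[2,3,4],[5,6,7,8]] := by decide +kernel
theorem g333 : Good9 {3,3,3} [[0,1,2],[3,4,5],[6,7,8]] := by decide +kernel
theorem g2223 : Good9 {2,2,2,3} [[0,1],[2,3],[4,5],[6,7,8]] := by decide +kernel

theorem gT : Good10 {10} [[0,1,2,3,4,5,6,7,8,9]] := by decide +kernel
theorem g28 : Good10 {2,8} [[0,1],[2,3,4,5,6,7,8,9]] := by decide +kernel
theorem g37 : Good10 {3,7} [[0,1,2],[3,4,5,6,7,8,9]] := by decide +kernel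
theorem g46 : Good10 {4,6} [[0,1,2,3],[4,5,6,7,8,9]] := by decide +kernel
theorem g55 : Good10 {5,5} [[0,1,2,3,4],[5,6,7,8,9]] := by decide +kernel
theorem g226 : Good10 {2,2,6} [[0,1],[2,3],[4,5,6,7,8,9]] := by decide +kernel
theorem g235 : Good10 {2,3,5} [[0,1],[2,3,4],[5,6,7,8,9]] := by decide +kernel
theorem g244 : Good10 {2,4,4} [[0,1],[2,3,4,5],[6,7,8,9]] := by decide +kernel
theorem g334 : Good10 {3,3,4} [[0,1,2],[3,4,5],[6,7,8,9]] := by decide +kernel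
theorem g2224 : Good10 {2,2,2,4} [[0,1],[2,3],[4,5],[6,7,8,9]] := by decide +kernel
theorem g2233 : Good10 {2,2,3,3} [[0,1],[2,3],[4,5,6],[7,8,9]] := by decide +kernel
theorem g22222 : Good10 {2,2,2,2,2} [[0,1],[2,3],[4,5],[6,7],[8,9]] := by decide +kernel

theorem exists9 (c : Multiset ℕ) (h2 : ∀ x ∈ c, 2 ≤ x) (hs : c.sum = 9) : ∃ l, Good9 c l := by
  obtain ⟨l, hsort, rfl⟩ : ∃ l : List ℕ, l.Pairwise (· ≤ ·) ∧ (l : Multiset ℕ) = c :=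
    ⟨c.sort (· ≤ ·), c.pairwise_sort (· ≤ ·), c.sort_eq (· ≤ ·)⟩
  have hmem : ∀ x ∈ l, 2 ≤ x := fun x hx => h2 x (by simpa using hx)
  rw [Multiset.sum_coe] at hs
  clear h2
  rcases l with _ | ⟨a, _ | ⟨b, _ | ⟨d, _ | ⟨e, _ | ⟨f, t⟩⟩⟩⟩⟩
  · simp at hs
  · simp at hs; subst hs; exact ⟨_, g9⟩
  · simp at hs hmem hsort
    have ha : a ≤ 4 := by omega
    obtain ⟨ha2, hb2⟩ := hmem
    interval_cases a
    · obtain rfl : b = 7 := by omega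
      exact ⟨_, g27⟩
    · obtain rfl : b = 6 := by omega
      exact ⟨_, g36⟩
    · obtain rfl : b = 5 := by omega
      exact ⟨_, g45⟩
  · simp at hs hmem hsort
    obtain ⟨ha2, hb2, hd2⟩ := hmem
    have : (a = 2 ∧ b = 2 ∧ d = 5) ∨ (a = 2 ∧ b = 3 ∧ d = 4) ∨ (a = 3 ∧ b = 3 ∧ d = 3) := by
      omega
    rcases this with ⟨rfl, rfl, rfl⟩ | ⟨rfl, rfl, rfl⟩ | ⟨rfl, rfl, rfl⟩
    · exact ⟨_, g225⟩
    · exact ⟨_, g234⟩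
    · exact ⟨_, g333⟩
  · simp at hs hmem hsort
    obtain ⟨ha2, hb2, hd2, he2⟩ := hmem
    have : a = 2 ∧ b = 2 ∧ d = 2 ∧ e = 3 := by omega
    rcases this with ⟨rfl, rfl, rfl, rfl⟩
    exact ⟨_, g2223⟩
  · simp at hs hmem
    omega

theorem exists10 (c : Multiset ℕ) (h2 : ∀ x ∈ c, 2 ≤ x) (hs : c.sum = 10) : ∃ l, Good10 c l := by
  obtain ⟨l, hsort, rfl⟩ : ∃ l : List ℕ, l.Pairwise (· ≤ ·) ∧ (l : Multiset ℕ) = c :=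
    ⟨c.sort (· ≤ ·), c.pairwise_sort (· ≤ ·), c.sort_eq (· ≤ ·)⟩
  have hmem : ∀ x ∈ l, 2 ≤ x := fun x hx => h2 x (by simpa using hx)
  rw [Multiset.sum_coe] at hs
  clear h2
  rcases l with _ | ⟨a, _ | ⟨b, _ | ⟨d, _ | ⟨e, _ | ⟨f, _ | ⟨g, t⟩⟩⟩⟩⟩⟩
  · simp at hs
  · simp at hs; subst hs; exact ⟨_, gT⟩
  · simp at hs hmem hsort
    have ha : a ≤ 5 := by omega
    obtain ⟨ha2, hb2⟩ := hmem
    interval_cases a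
    · obtain rfl : b = 8 := by omega
      exact ⟨_, g28⟩
    · obtain rfl : b = 7 := by omega
      exact ⟨_, g37⟩
    · obtain rfl : b = 6 := by omega
      exact ⟨_, g46⟩
    · obtain rfl : b = 5 := by omega
      exact ⟨_, g55⟩
  · simp at hs hmem hsort
    obtain ⟨ha2, hb2, hd2⟩ := hmem
    have : (a = 2 ∧ b = 2 ∧ d = 6) ∨ (a = 2 ∧ b = 3 ∧ d = 5) ∨ (a = 2 ∧ b = 4 ∧ d = 4) ∨
        (a = 3 ∧ b = 3 ∧ d = 4) := by
      omega
    rcases this with ⟨rfl, rfl, rfl⟩ | ⟨rfl, rfl, rfl⟩ | ⟨rfl, rfl, rfl⟩ | ⟨rfl, rfl, rfl⟩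
    · exact ⟨_, g226⟩
    · exact ⟨_, g235⟩
    · exact ⟨_, g244⟩
    · exact ⟨_, g334⟩
  · simp at hs hmem hsort
    obtain ⟨ha2, hb2, hd2, he2⟩ := hmem
    have : (a = 2 ∧ b = 2 ∧ d = 2 ∧ e = 4) ∨ (a = 2 ∧ b = 2 ∧ d = 3 ∧ e = 3) := by omega
    rcases this with ⟨rfl, rfl, rfl, rfl⟩ | ⟨rfl, rfl, rfl, rfl⟩
    · exact ⟨_, g2224⟩
    · exact ⟨_, g2233⟩
  · simp at hs hmem
    obtain ⟨ha2, hb2, hd2, he2, hf2⟩ := hmem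
    have : a = 2 ∧ b = 2 ∧ d = 2 ∧ e = 2 ∧ f = 2 := by omega
    rcases this with ⟨rfl, rfl, rfl, rfl, rfl⟩
    exact ⟨_, g22222⟩
  · simp at hs hmem
    omega

theorem upper {n : ℕ} (hn : 10 ≤ n) (π τ : Perm (Fin n)) (h : 9 ≤ hdist π τ) :
    interCard π τ ≤ 18 := by
  rcases Nat.lt_or_ge 10 (hdist π τ) with h10 | h10
  · have : pball π 5 ∩ pball τ 5 = ∅ := by
      rw [Finset.eq_empty_iff_forall_notMem]
      intro s hs
      rw [mem_inter] at hs
      have := hdist_tri π s τ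
      rw [hdist_symm s τ] at this
      omega
    simp [interCard, this]
  rw [← interCard_mul_left τ⁻¹, inv_mul_cancel]
  rw [hdist_symm, hdist_eq_support] at h h10
  generalize τ⁻¹ * π = ρ at *
  rw [← sum_cycleType] at h h10
  have h2 : ∀ x ∈ ρ.cycleType, 2 ≤ x := fun x hx => two_le_of_mem_cycleType hx
  rcases (by omega : ρ.cycleType.sum = 9 ∨ ρ.cycleType.sum = 10) with hs | hs
  · obtain ⟨l, hl, hf, hc⟩ := exists9 _ h2 hs
    have hconj : IsConj ρ (extP (by omega : 9 ≤ n) (cyc l)) := by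
      rw [isConj_iff_cycleType_eq, ← hl]
      exact (cycleType_extendDomain _).symm
    rw [interCard_conj hconj, interCard_extP _ (le_refl _) _ hf]
    exact (bound9 _ hf).trans hc
  · obtain ⟨l, hl, hf, hc⟩ := exists10 _ h2 hs
    have hconj : IsConj ρ (extP (by omega : 10 ≤ n) (cyc l)) := by
      rw [isConj_iff_cycleType_eq, ← hl]
      exact (cycleType_extendDomain _).symm
    rw [interCard_conj hconj, interCard_extP _ (by omega) _ hf]
    exact (bound10 _ hf).trans hc

/-- The extremal permutation on nine points. -/
def ext9 : Perm (Fin 9) := cyc [[0,1,2],[3,4,5],[6,7,8]]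

/-- The eighteen permutations in the intersection: a full 3-cycle times a transposition
inside another 3-cycle. -/
def wit : List (Perm (Fin 9)) :=
  [([0,1,2] : List (Fin 9)), [3,4,5], [6,7,8]].flatMap fun c =>
    ([[3,4],[3,5],[4,5],[6,7],[6,8],[7,8],[0,1],[0,2],[1,2]] : List (List (Fin 9))).filterMap
      fun d => if d.all (fun x => !c.contains x) then some (cyc [c, d]) else none

theorem lower9 : 18 ≤ interCard ext9 1 := by
  have h1 : wit.Nodup := by decide +kernel
  have h2 : wit.length = 18 := by decide +kernel
  have h3 : ∀ s ∈ wit, hdist ext9 s ≤ 5 ∧ hdist 1 s ≤ 5 := by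
    have h4 : (wit.all fun s => decide (hdist ext9 s ≤ 5 ∧ hdist 1 s ≤ 5)) = true := by
      decide +kernel
    intro s hs
    exact of_decide_eq_true (List.all_eq_true.1 h4 s hs)
  rw [← h2, ← List.toFinset_card_of_nodup h1]
  apply Finset.card_le_card
  intro s hs
  rw [mem_inter]
  exact h3 s (List.mem_toFinset.1 hs)

theorem lower {n : ℕ} (hn : 10 ≤ n) : ∃ π τ : Perm (Fin n), 9 ≤ hdist π τ ∧
    interCard π τ = 18 := by
  have h9 : 9 ≤ n := by omega
  have hd : 9 ≤ hdist (extP h9 ext9) 1 := by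
    rw [← extP_one h9, hdist_extP]
    unfold hdist
    decide +kernel
  refine ⟨extP h9 ext9, 1, hd, le_antisymm (upper hn _ _ hd) ?_⟩
  rw [interCard_extP h9 (le_refl _) ext9 g333.2.1]
  exact lower9

/-- For all `n ≥ 10`, `N(n, 9, 5) = 18`; that is, (1) every pair of
permutations of `Fin n` at Hamming distance `≥ 9` satisfies `|B_5(π) ∩ B_5(τ)| ≤ 18`,
and (2) some pair at distance `≥ 9` attains `18`. -/
theorem stmt19 (n : ℕ) (hn : 10 ≤ n) :
    Nmax n 9 5 = 18 ∧
    (∀ π τ : Equiv.Perm (Fin n), 9 ≤ hdist π τ →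
        (pball π 5 ∩ pball τ 5).card ≤ 18) ∧
    (∃ π τ : Equiv.Perm (Fin n), 9 ≤ hdist π τ ∧
        (pball π 5 ∩ pball τ 5).card = 18) := by
  have hl := lower hn
  refine ⟨le_antisymm ?_ ?_, fun π τ h => upper hn π τ h, hl⟩
  · apply Finset.sup_le
    intro p hp
    exact upper hn p.1 p.2 (Finset.mem_filter.1 hp).2
  · obtain ⟨π, τ, h1, h2⟩ := hl
    rw [← h2]
    exact Finset.le_sup (f := fun p : Perm (Fin n) × Perm (Fin n) =>
      (pball p.1 5 ∩ pball p.2 5).card) (b := (π, τ)) (by simpa using h1)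
end
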